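/- arXiv:1609.09374 — 13 statements merged into one kernel-verified Lean document; each statement's English description precedes it below -/
import Mathlib

section
/- Let G be a finite forest and λ ∈ ℝ. Then the multiplicity of λ as an eigenvalue of the adjacency matrix A of G (i.e., the dimension of the kernel of A − λI as a real linear map) equals the number of connected components of the subgraph of G induced by the λ-support 𝔖_λ minus the cardinality of the boundary ∂𝔖_λ. -/
open Classical Matrix

section

variable {V : Type*} [Fintype V] {G : SimpleGraph V}

/-- A circulation on the edges of a finite forest vanishes. -/
theorem SimpleGraph.IsAcyclic.circulation_eq_zero (hG : G.IsAcyclic) (w : V → V → ℝ)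
    (hanti : ∀ y z, w z y = -w y z) (hadj : ∀ y z, ¬ G.Adj y z → w y z = 0)
    (hdiv : ∀ y, ∑ z, w y z = 0) (a b : V) : w a b = 0 := by
  by_cases hab : G.Adj a b
  swap
  · exact hadj a b hab
  have hbridge := SimpleGraph.isBridge_iff.1
    (SimpleGraph.isAcyclic_iff_forall_adj_isBridge.1 hG hab)
  set H := G.deleteEdges {s(a, b)} with hH
  let D : Finset V := Finset.univ.filter fun y => H.Reachable a y
  have haD : a ∈ D := by simp [D]
  have hbD : b ∈ Dᶜ := by simpa [D] using hbridge
  have hinner : ∑ y ∈ D, ∑ z ∈ D, w y z = 0 := by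
    have h : ∑ y ∈ D, ∑ z ∈ D, w y z = -∑ y ∈ D, ∑ z ∈ D, w y z := by
      conv_lhs => rw [Finset.sum_comm]
      simp_rw [← Finset.sum_neg_distrib]
      exact Finset.sum_congr rfl fun y _ => Finset.sum_congr rfl fun z _ => hanti y z
    linarith
  have hcut : ∀ y ∈ D, ∀ z ∈ Dᶜ, ¬(y = a ∧ z = b) → w y z = 0 := by
    intro y hy z hz hne
    refine hadj y z fun hyz => ?_
    simp only [D, Finset.mem_compl, Finset.mem_filter, Finset.mem_univ, true_and] at hy hz
    refine hz (hy.trans (SimpleGraph.Adj.reachable ?_))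
    rw [hH, SimpleGraph.deleteEdges_adj]
    refine ⟨hyz, fun hmem => ?_⟩
    rcases Sym2.eq_iff.1 (Set.mem_singleton_iff.1 hmem) with h | ⟨-, rfl⟩
    · exact hne h
    · exact hz (SimpleGraph.Reachable.refl _)
  have houter : ∑ y ∈ D, ∑ z ∈ Dᶜ, w y z = w a b := by
    rw [Finset.sum_eq_single_of_mem a haD, Finset.sum_eq_single_of_mem b hbD]
    · exact fun z hz hne => hcut a haD z hz fun h => hne h.2
    · exact fun y hy hne => Finset.sum_eq_zero fun z hz => hcut y hy z hz fun h => hne h.1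
  have htotal : ∑ y ∈ D, ∑ z, w y z = 0 := Finset.sum_eq_zero fun y _ => hdiv y
  simp_rw [← Finset.sum_add_sum_compl D] at htotal
  rw [Finset.sum_add_distrib, hinner, houter, zero_add] at htotal
  exact htotal

/-- The Wronskian of a kernel vector `φ` of a symmetric matrix supported on a forest with a vector
`ψ` whose image vanishes on the support of `φ` is zero along every edge. -/
theorem SimpleGraph.IsAcyclic.mul_eq_mul_of_adj (hG : G.IsAcyclic) {B : Matrix V V ℝ}
    (hB : B.IsSymm) (hBadj : ∀ y z, y ≠ z → (B y z ≠ 0 ↔ G.Adj y z)) {φ ψ : V → ℝ}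
    (hφ : B *ᵥ φ = 0) (hψ : ∀ y, φ y ≠ 0 → (B *ᵥ ψ) y = 0) {y z : V} (hyz : G.Adj y z) :
    φ y * ψ z = φ z * ψ y := by
  have h := hG.circulation_eq_zero (fun y z => B y z * (φ y * ψ z - φ z * ψ y))
    (fun y z => by simp only [hB.apply y z]; ring)
    (fun y z hyz => by
      by_cases h : y = z
      · subst h; ring
      · rw [not_not.1 fun h0 => hyz ((hBadj y z h).1 h0), zero_mul])
    (fun y => by
      have h1 : ∑ z, B y z * (φ y * ψ z - φ z * ψ y)
          = φ y * (B *ᵥ ψ) y - ψ y * (B *ᵥ φ) y := by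
        simp only [mulVec, dotProduct, Finset.mul_sum, ← Finset.sum_sub_distrib]
        exact Finset.sum_congr rfl fun z _ => by ring
      rw [h1, hφ]
      by_cases h : φ y = 0
      · simp [h]
      · simp [hψ y h]) y z
  have h0 := (hBadj y z hyz.ne).2 hyz
  linarith [(mul_eq_zero.1 h).resolve_left h0]

/-- Rank-nullity for a matrix and its transpose. -/
theorem Matrix.finrank_ker_add_card_eq_transpose {m n : Type*} [Fintype m] [Fintype n]
    (N : Matrix m n ℝ) :
    Module.finrank ℝ (LinearMap.ker N.mulVecLin) + Fintype.card m
      = Module.finrank ℝ (LinearMap.ker Nᵀ.mulVecLin) + Fintype.card n := by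
  have h1 := LinearMap.finrank_range_add_finrank_ker N.mulVecLin
  have h2 := LinearMap.finrank_range_add_finrank_ker Nᵀ.mulVecLin
  have h3 : Module.finrank ℝ (LinearMap.range Nᵀ.mulVecLin)
    = Module.finrank ℝ (LinearMap.range N.mulVecLin) := Matrix.rank_transpose N
  rw [Module.finrank_fintype_fun_eq_card] at h1 h2
  omega

theorem Matrix.mulVec_extend_zero_apply {S : Set V} (B : Matrix V V ℝ) (ψ : S → ℝ) (v : V) :
    (B *ᵥ Function.extend Subtype.val ψ 0) v = ∑ s : S, B v s * ψ s := by
  have h : ∀ s : S, B v s * ψ s = B v s * Function.extend Subtype.val ψ 0 (s : V) := fun s => by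
    rw [Subtype.val_injective.extend_apply]
  simp_rw [h, mulVec, dotProduct]
  rw [Finset.sum_set_coe S (f := fun z => B v z * Function.extend Subtype.val ψ 0 z)]
  refine (Finset.sum_subset (Finset.subset_univ _) fun z _ hz => ?_).symm
  rw [Function.extend_apply' _ _ _ (by rintro ⟨s, rfl⟩; exact hz (by simp)), Pi.zero_apply,
    mul_zero]

theorem Function.extend_val_zero_restrict {V : Type*} {S : Set V} {ψ : V → ℝ}
    (h : ∀ v ∉ S, ψ v = 0) :
    Function.extend Subtype.val (fun s : S => ψ s) 0 = ψ := by
  ext v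
  by_cases hv : v ∈ S
  · exact Subtype.val_injective.extend_apply (fun s : S => ψ s) 0 ⟨v, hv⟩
  · rw [Function.extend_apply' _ _ _ (by rintro ⟨s, rfl⟩; exact hv s.2), h v hv, Pi.zero_apply]

/-- If every kernel vector of `B` vanishes off `S`, and `B` has no nonzero entry from outside `P`
into `S`, then the nullity of `B` is that of its `P × S` block. -/
theorem Matrix.finrank_ker_eq_finrank_ker_submatrix {B : Matrix V V ℝ} {S P : Set V}
    (hS : ∀ ψ, B *ᵥ ψ = 0 → ∀ v ∉ S, ψ v = 0) (hP : ∀ v ∉ P, ∀ s ∈ S, B v s = 0) :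
    Module.finrank ℝ (LinearMap.ker B.mulVecLin) = Module.finrank ℝ (LinearMap.ker
      (B.submatrix (Subtype.val : P → V) (Subtype.val : S → V)).mulVecLin) := by
  have hinj : Function.Injective
      (Function.ExtendByZero.linearMap ℝ (Subtype.val : S → V)) :=
    Function.extend_injective Subtype.val_injective (0 : V → ℝ)
  rw [(Submodule.equivMapOfInjective _ hinj _).finrank_eq]
  suffices h : LinearMap.ker B.mulVecLin = Submodule.map
      (Function.ExtendByZero.linearMap ℝ (Subtype.val : S → V)) (LinearMap.ker
        (B.submatrix (Subtype.val : P → V) (Subtype.val : S → V)).mulVecLin) by rw [h]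
  ext ψ
  simp only [Submodule.mem_map, LinearMap.mem_ker, mulVecLin_apply]
  constructor
  · intro h
    refine ⟨fun s => ψ s, ?_, Function.extend_val_zero_restrict (hS ψ h)⟩
    ext p
    have := Matrix.mulVec_extend_zero_apply (S := S) B (fun s => ψ s) p
    rw [Function.extend_val_zero_restrict (hS ψ h), h] at this
    exact this.symm
  · rintro ⟨χ, hχ, rfl⟩
    ext v
    refine (Matrix.mulVec_extend_zero_apply B χ v).trans ?_
    by_cases hv : v ∈ P
    · exact congrFun hχ ⟨v, hv⟩
    · exact Finset.sum_eq_zero fun s _ => by rw [hP v hv s s.2, zero_mul]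

/-- Multiplication of `φ` by functions constant on the connected components of the subgraph
induced by `S`, extended by zero to `P`. -/
noncomputable def SimpleGraph.componentScaling {V : Type*} (G : SimpleGraph V) (φ : V → ℝ)
    (S P : Set V) : ((G.induce S).ConnectedComponent → ℝ) →ₗ[ℝ] (P → ℝ) where
  toFun c p := if h : (p : V) ∈ S then c ((G.induce S).connectedComponentMk ⟨p, h⟩) * φ p else 0
  map_add' c d := by
    ext p
    simp only [Pi.add_apply]
    split_ifs <;> ring
  map_smul' r c := by
    ext p
    simp only [Pi.smul_apply, smul_eq_mul, RingHom.id_apply]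
    split_ifs <;> ring

theorem SimpleGraph.componentScaling_injective {V : Type*} {G : SimpleGraph V}
    {φ : V → ℝ} {S P : Set V} (hφS : ∀ v ∈ S, φ v ≠ 0) (hSP : S ⊆ P) :
    Function.Injective (G.componentScaling φ S P) := by
  intro c d h
  ext C
  induction C using SimpleGraph.ConnectedComponent.ind with
  | h s =>
    have hs := congrFun h ⟨s, hSP s.2⟩
    simp only [SimpleGraph.componentScaling, LinearMap.coe_mk, AddHom.coe_mk, s.2,
      dite_true] at hs
    exact mul_right_cancel₀ (hφS s s.2) hs

/-- Let `φ` be a kernel vector of `B` with support `S`, and let `P` be `S` together with some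
vertices adjacent to `S`. The kernel of the `S × P` block of `B` consists of the multiples of `φ`
by functions constant on the components of `S`. -/
theorem SimpleGraph.IsAcyclic.ker_submatrix_eq_range (hG : G.IsAcyclic) {B : Matrix V V ℝ}
    (hB : B.IsSymm) (hBadj : ∀ y z, y ≠ z → (B y z ≠ 0 ↔ G.Adj y z)) {φ : V → ℝ}
    (hφ : B *ᵥ φ = 0) {S P : Set V} (hφS : ∀ v, v ∈ S ↔ φ v ≠ 0) (hSP : S ⊆ P)
    (hP : ∀ v ∈ P, v ∉ S → ∃ s ∈ S, G.Adj v s) :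
    LinearMap.ker (B.submatrix (Subtype.val : S → V) (Subtype.val : P → V)).mulVecLin
      = LinearMap.range (G.componentScaling φ S P) := by
  ext ψ
  have hker : ∀ s : S, (B.submatrix (Subtype.val : S → V) (Subtype.val : P → V) *ᵥ ψ) s
      = (B *ᵥ Function.extend Subtype.val ψ 0) s :=
    fun s => (Matrix.mulVec_extend_zero_apply B ψ s).symm
  have hext : ∀ p : P, Function.extend Subtype.val ψ 0 (p : V) = ψ p :=
    fun p => Subtype.val_injective.extend_apply ψ 0 p
  rw [LinearMap.mem_ker, mulVecLin_apply, LinearMap.mem_range]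
  constructor
  · intro h
    have hW := @SimpleGraph.IsAcyclic.mul_eq_mul_of_adj V _ G hG B hB hBadj φ
      (Function.extend Subtype.val ψ 0) hφ
      fun y hy => by rw [← hker ⟨y, (hφS y).2 hy⟩, h, Pi.zero_apply]
    have hconst : ∀ s t : S, (G.induce S).Reachable s t →
        ψ ⟨s, hSP s.2⟩ / φ s = ψ ⟨t, hSP t.2⟩ / φ t := by
      rintro s t ⟨p⟩
      induction p with
      | nil => rfl
      | @cons u v w huv _ ih =>
        rw [← ih]
        have := hW (SimpleGraph.induce_adj.1 huv)
        rw [hext ⟨u, hSP u.2⟩, hext ⟨v, hSP v.2⟩] at this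
        rw [div_eq_div_iff ((hφS u).1 u.2) ((hφS v).1 v.2)]
        linarith
    refine ⟨SimpleGraph.ConnectedComponent.lift (fun s : S => ψ ⟨s, hSP s.2⟩ / φ s)
      fun s t p _ => hconst s t ⟨p⟩, ?_⟩
    ext p
    simp only [SimpleGraph.componentScaling, LinearMap.coe_mk, AddHom.coe_mk]
    split_ifs with hp
    · exact div_mul_cancel₀ _ ((hφS p).1 hp)
    · obtain ⟨s, hs, hadj⟩ := hP p p.2 hp
      have := hW hadj
      rw [hext p, not_not.1 fun h0 => hp ((hφS p).2 h0), zero_mul] at this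
      exact ((mul_eq_zero.1 this.symm).resolve_left ((hφS s).1 hs)).symm
  · rintro ⟨c, hc⟩
    ext s
    have hs : ∑ z, B s z * φ z = 0 := congrFun hφ s
    rw [hker, Pi.zero_apply, mulVec, dotProduct,
      ← mul_zero (c ((G.induce S).connectedComponentMk s)), ← hs, Finset.mul_sum]
    refine Finset.sum_congr rfl fun z _ => ?_
    by_cases hz : z ∈ S
    · rw [hext ⟨z, hSP hz⟩, ← hc]
      simp only [SimpleGraph.componentScaling, LinearMap.coe_mk, AddHom.coe_mk, hz, dite_true]
      by_cases hBz : B s z = 0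
      · simp [hBz]
      have hcomp : (G.induce S).connectedComponentMk ⟨z, hz⟩
          = (G.induce S).connectedComponentMk s := by
        by_cases hsz : (s : V) = z
        · subst hsz; rfl
        · refine SimpleGraph.ConnectedComponent.sound (SimpleGraph.Adj.reachable ?_)
          exact SimpleGraph.induce_adj.2 ((hBadj s z hsz).1 hBz).symm
      rw [hcomp]
      ring
    · have hφz : φ z = 0 := not_not.1 fun h0 => hz ((hφS z).2 h0)
      rw [hφz]
      by_cases hzP : z ∈ P
      · rw [hext ⟨z, hzP⟩, ← hc]
        simp [SimpleGraph.componentScaling, hz]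
      · rw [Function.extend_apply' _ _ _ (by rintro ⟨p, rfl⟩; exact hzP p.2)]
        simp

/-- The kernel of a matrix contains a vector that is nonzero wherever some kernel vector is. -/
theorem Matrix.exists_mulVec_eq_zero_forall_ne_zero (B : Matrix V V ℝ) :
    ∃ φ : V → ℝ, B *ᵥ φ = 0 ∧ ∀ ψ : V → ℝ, B *ᵥ ψ = 0 → ∀ v, ψ v ≠ 0 → φ v ≠ 0 := by
  obtain ⟨φ, hφ, hne⟩ := Module.Dual.exists_forall_mem_ne_zero_of_forall_exists
    (LinearMap.ker B.mulVecLin)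
    (fun v : {v : V // ∃ ψ : V → ℝ, B *ᵥ ψ = 0 ∧ ψ v ≠ 0} => LinearMap.proj (R := ℝ) (v : V))
    (fun v => by
      obtain ⟨ψ, hψ, hv⟩ := v.2
      exact ⟨ψ, hψ, hv⟩)
  exact ⟨φ, hφ, fun ψ hψ v hv => hne ⟨v, ψ, hψ, hv⟩⟩

end

/-- For a finite forest `G` and `λ ∈ ℝ`, the multiplicity of `λ` as an
eigenvalue of the adjacency matrix `A` (the dimension of the kernel of `A - λI`) equals the
number of connected components of the subgraph induced by the `λ`-support `𝔖_λ` minus the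
cardinality of the boundary `∂𝔖_λ`. -/
theorem stmt_0 {V : Type*} [Fintype V] [DecidableEq V]
    (G : SimpleGraph V) [DecidableRel G.Adj] (hG : G.IsAcyclic) (lam : ℝ)
    (supp : Set V)
    (hsupp : supp = {o : V | ∃ φ : V → ℝ, φ ≠ 0 ∧
      G.adjMatrix ℝ *ᵥ φ = lam • φ ∧ φ o ≠ 0})
    (bd : Set V)
    (hbd : bd = {x : V | x ∉ supp ∧ ∃ y ∈ supp, G.Adj x y}) :
    (Module.finrank ℝ
        (LinearMap.ker (Matrix.toLin' (G.adjMatrix ℝ - lam • 1))) : ℤ)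
      = (Nat.card ((G.induce supp).ConnectedComponent) : ℤ) - (bd.ncard : ℤ) := by
  set B : Matrix V V ℝ := G.adjMatrix ℝ - lam • 1 with hBdef
  have hB : B.IsSymm := (G.isSymm_adjMatrix (α := ℝ)).sub (Matrix.isSymm_one.smul lam)
  have hBadj : ∀ y z, y ≠ z → (B y z ≠ 0 ↔ G.Adj y z) := fun y z hyz => by
    simp [hBdef, hyz]
  have hBker : ∀ ψ : V → ℝ, B *ᵥ ψ = 0 ↔ G.adjMatrix ℝ *ᵥ ψ = lam • ψ := fun ψ => by
    rw [hBdef, sub_mulVec, smul_mulVec, one_mulVec, sub_eq_zero]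
  obtain ⟨φ, hφ, hmax⟩ := Matrix.exists_mulVec_eq_zero_forall_ne_zero B
  have hφS : ∀ v, v ∈ supp ↔ φ v ≠ 0 := fun v => by
    rw [hsupp]
    constructor
    · rintro ⟨ψ, -, hψ, hv⟩
      exact hmax ψ ((hBker ψ).2 hψ) v hv
    · exact fun hv => ⟨φ, fun h => hv (by rw [h, Pi.zero_apply]), (hBker φ).1 hφ, hv⟩
  have hbdmem : ∀ v, v ∈ bd ↔ v ∉ supp ∧ ∃ y ∈ supp, G.Adj v y := fun v => by rw [hbd]; rfl
  obtain ⟨P, hP⟩ : ∃ P, P = supp ∪ bd := ⟨_, rfl⟩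
  have hSP : supp ⊆ P := hP ▸ Set.subset_union_left
  have hrestrict := Matrix.finrank_ker_eq_finrank_ker_submatrix (B := B) (S := supp)
    (P := P)
    (fun ψ hψ v hv => not_not.1 fun h0 => hv ((hφS v).2 (hmax ψ hψ v h0)))
    (fun v hv s hs => by
      by_contra h0
      have hvs : v ≠ s := by rintro rfl; exact hv (hSP hs)
      exact hv (hP ▸ Or.inr ((hbdmem v).2
        ⟨fun h => hv (hSP h), s, hs, (hBadj v s hvs).1 h0⟩)))
  have hrank := Matrix.finrank_ker_add_card_eq_transpose
    (B.submatrix (Subtype.val : P → V) (Subtype.val : supp → V))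
  rw [Matrix.transpose_submatrix, hB.eq, hG.ker_submatrix_eq_range hB hBadj hφ hφS hSP
      (fun v hv hvS => ((hbdmem v).1 ((hP ▸ hv : v ∈ supp ∪ bd).resolve_left hvS)).2),
    LinearMap.finrank_range_of_inj (SimpleGraph.componentScaling_injective
      (fun v hv => (hφS v).1 hv) hSP),
    Module.finrank_fintype_fun_eq_card, ← hrestrict] at hrank
  have hdisj : Disjoint supp bd := Set.disjoint_right.2 fun v hv => ((hbdmem v).1 hv).1
  have hcard := Set.ncard_union_eq hdisj
  simp only [← Nat.card_eq_fintype_card, Nat.card_coe_set_eq, hP, hcard] at hrank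
  change (Module.finrank ℝ (LinearMap.ker B.mulVecLin) : ℤ) = _
  omega
end

section
/- Let G be a finite forest and λ ∈ ℝ. Then every connected component of the subgraph of G induced by the λ-support 𝔖_λ admits a nowhere-vanishing λ-eigenfunction; that is, for each component with vertex set S there exists φ : S → ℝ with φ(x) ≠ 0 for every x ∈ S and Σ_{y ∈ S, y adjacent to x} φ(y) = λ·φ(x) for every x ∈ S. -/
open Classical Matrix

/-- Some vector of the `μ`-eigenspace of a real square matrix is nonzero at every coordinate at
which the eigenspace does not vanish identically. -/
theorem exists_mulVec_eq_smul_forall_ne_zero {V : Type*} [Fintype V]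
    (A : Matrix V V ℝ) (μ : ℝ) :
    ∃ ψ : V → ℝ, A *ᵥ ψ = μ • ψ ∧
      ∀ o : V, (∃ φ : V → ℝ, A *ᵥ φ = μ • φ ∧ φ o ≠ 0) → ψ o ≠ 0 := by
  let E : Submodule ℝ (V → ℝ) := LinearMap.eqLocus A.mulVecLin (μ • LinearMap.id)
  obtain ⟨ψ, hψ, hne⟩ := Module.Dual.exists_forall_mem_ne_zero_of_forall_exists E
    (fun o : {o : V // ∃ φ : V → ℝ, A *ᵥ φ = μ • φ ∧ φ o ≠ 0} ↦ LinearMap.proj (o : V))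
    (fun o ↦ o.2)
  exact ⟨ψ, hψ, fun o ho ↦ hne ⟨o, ho⟩⟩

/-- For a finite forest `G` and `λ ∈ ℝ`, every connected component of the
subgraph induced by the `λ`-support `𝔖_λ` admits a nowhere-vanishing `λ`-eigenfunction:
for the vertex set `S` of such a component there is `φ : S → ℝ` with `φ x ≠ 0` for all
`x ∈ S` and `∑_{y ∈ S, y ~ x} φ y = λ · φ x` for all `x ∈ S`. -/
theorem stmt_1 {V : Type*} [Fintype V] [DecidableEq V]
    (G : SimpleGraph V) [DecidableRel G.Adj] (hG : G.IsAcyclic) (lam : ℝ)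
    (supp : Set V)
    (hsupp : supp = {o : V | ∃ φ : V → ℝ, φ ≠ 0 ∧
      G.adjMatrix ℝ *ᵥ φ = lam • φ ∧ φ o ≠ 0})
    (c : (G.induce supp).ConnectedComponent)
    (S : Set V) (hS : S = Subtype.val '' c.supp) :
    ∃ φ : S → ℝ, (∀ x : S, φ x ≠ 0) ∧
      ∀ x : S, (∑ y : S, if G.Adj (x : V) (y : V) then φ y else 0) = lam * φ x := by
  obtain ⟨ψ, hψ, hne⟩ := exists_mulVec_eq_smul_forall_ne_zero (G.adjMatrix ℝ) lam
  have hmem : ∀ o, o ∈ supp ↔ ψ o ≠ 0 := by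
    intro o
    rw [hsupp]
    constructor
    · rintro ⟨φ, -, hφ, ho⟩
      exact hne o ⟨φ, hφ, ho⟩
    · exact fun ho ↦ ⟨ψ, fun h ↦ ho (congrFun h o), hψ, ho⟩
  refine ⟨fun x ↦ ψ x, ?_, ?_⟩
  · rintro ⟨x, hx⟩
    obtain ⟨o, -, rfl⟩ := hS ▸ hx
    exact (hmem o).1 o.2
  · rintro ⟨x, hx⟩
    have hclosed : ∀ y, G.Adj x y → ψ y ≠ 0 → y ∈ S := by
      intro y hxy hy
      subst hS
      obtain ⟨o, ho, rfl⟩ := hx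
      exact ⟨⟨y, (hmem y).2 hy⟩, c.mem_supp_of_adj_mem_supp ho hxy, rfl⟩
    have hsum := congrFun hψ x
    rw [SimpleGraph.adjMatrix_mulVec_apply, SimpleGraph.neighborFinset_eq_filter,
      Finset.sum_filter, Pi.smul_apply, smul_eq_mul] at hsum
    rw [← hsum]
    refine Fintype.sum_of_injective Subtype.val Subtype.val_injective _ _ ?_ fun _ ↦ rfl
    intro y hy
    by_contra h
    have hxy : G.Adj x y := by_contra fun h' ↦ h (if_neg h')
    rw [if_pos hxy] at h
    exact hy ⟨⟨y, hclosed y hxy h⟩, rfl⟩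
end

section
/- Let G be a finite forest and λ ∈ ℝ. Then every vertex in the boundary ∂𝔖_λ of the λ-support has at least two neighbors belonging to 𝔖_λ. -/
open Classical Matrix

/-- For a finite forest `G` and `λ ∈ ℝ`, every vertex in the boundary
`∂𝔖_λ` of the `λ`-support has at least two neighbors belonging to `𝔖_λ`. -/
theorem stmt_2 {V : Type*} [Fintype V] [DecidableEq V]
    (G : SimpleGraph V) [DecidableRel G.Adj] (hG : G.IsAcyclic) (lam : ℝ)
    (supp : Set V)
    (hsupp : supp = {o : V | ∃ φ : V → ℝ, φ ≠ 0 ∧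
      G.adjMatrix ℝ *ᵥ φ = lam • φ ∧ φ o ≠ 0})
    (bd : Set V)
    (hbd : bd = {x : V | x ∉ supp ∧ ∃ y ∈ supp, G.Adj x y})
    (o : V) (ho : o ∈ bd) :
    2 ≤ {y : V | y ∈ supp ∧ G.Adj o y}.ncard := by
  subst hbd hsupp
  obtain ⟨ho, y, ⟨φ, hφ, hA, hy⟩, hoy⟩ := ho
  have hφo : φ o = 0 := by
    by_contra h
    exact ho ⟨φ, hφ, hA, h⟩
  have hsum : ∑ z ∈ G.neighborFinset o, φ z = 0 := by
    have h := congrFun hA o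
    rwa [SimpleGraph.adjMatrix_mulVec_apply, Pi.smul_apply, hφo, smul_zero] at h
  obtain ⟨z, hz, hzy, hφz⟩ : ∃ z, G.Adj o z ∧ z ≠ y ∧ φ z ≠ 0 := by
    by_contra! h
    rw [Finset.sum_eq_single_of_mem y (by simpa using hoy)
      (fun z hz hzy => h z (by simpa using hz) hzy)] at hsum
    exact hy hsum
  exact (Set.one_lt_ncard (Set.toFinite _)).2
    ⟨y, ⟨⟨φ, hφ, hA, hy⟩, hoy⟩, z, ⟨⟨φ, hφ, hA, hφz⟩, hz⟩, hzy.symm⟩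
end

section
/- Let T be a finite tree with vertex set V, adjacency matrix A, and let λ ∈ ℝ. The following are equivalent: (i) there exists φ : V → ℝ with φ(o) ≠ 0 for every o ∈ V and Aφ = λφ; (ii) λ is an eigenvalue of A, but for every vertex o ∈ V, λ is not an eigenvalue of the adjacency matrix of the subgraph induced on V ∖ {o}. -/
open Classical Matrix

/-- A skew-symmetric function on pairs sums to zero over any square. -/
theorem sum_sum_eq_zero_of_skew {V : Type*} (s : Finset V) (F : V → V → ℝ)
    (hF : ∀ u v, F u v = -F v u) : ∑ u ∈ s, ∑ v ∈ s, F u v = 0 := by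
  have h : ∑ u ∈ s, ∑ v ∈ s, F u v = -∑ u ∈ s, ∑ v ∈ s, F u v := by
    conv_lhs => rw [Finset.sum_comm]
    simp only [← Finset.sum_neg_distrib]
    exact Finset.sum_congr rfl fun u _ => Finset.sum_congr rfl fun v _ => hF v u
  linarith

/-- A divergence-free flow on a finite acyclic graph vanishes. -/
theorem SimpleGraph.IsAcyclic.flow_eq_zero {V : Type*} [Fintype V] {G : SimpleGraph V}
    (hG : G.IsAcyclic) {F : V → V → ℝ} (hskew : ∀ u v, F u v = -F v u)
    (hsupp : ∀ u v, ¬ G.Adj u v → F u v = 0) (hdiv : ∀ u, ∑ v, F u v = 0) (x y : V) :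
    F x y = 0 := by
  by_cases hxy : G.Adj x y
  swap
  · exact hsupp x y hxy
  have hbridge : ¬ (G.deleteEdges {s(x, y)}).Reachable x y :=
    SimpleGraph.isBridge_iff.mp (SimpleGraph.isAcyclic_iff_forall_adj_isBridge.mp hG hxy)
  let S : Finset V := Finset.univ.filter fun v => (G.deleteEdges {s(x, y)}).Reachable x v
  have hS : ∀ v, v ∈ S ↔ (G.deleteEdges {s(x, y)}).Reachable x v := fun v => by simp [S]
  have hxS : x ∈ S := (hS x).2 (SimpleGraph.Reachable.refl x)
  have hyS : y ∉ S := fun h => hbridge ((hS y).1 h)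
  have hcross : ∀ u ∈ S, ∀ v ∉ S, (u, v) ≠ (x, y) → F u v = 0 := by
    intro u hu v hv hne
    refine hsupp u v fun hadj => ?_
    by_cases he : s(u, v) = s(x, y)
    · rcases Sym2.eq_iff.mp he with ⟨rfl, rfl⟩ | ⟨rfl, rfl⟩
      · exact hne rfl
      · exact hyS hu
    · refine hv ((hS v).2 (((hS u).1 hu).trans (SimpleGraph.Adj.reachable ?_)))
      rw [SimpleGraph.deleteEdges_adj]
      exact ⟨hadj, he⟩
  have htotal : ∑ u ∈ S, ∑ v ∈ Sᶜ, F u v = 0 := by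
    have h : ∑ u ∈ S, (∑ v ∈ S, F u v + ∑ v ∈ Sᶜ, F u v) = 0 :=
      Finset.sum_eq_zero fun u _ => by rw [Finset.sum_add_sum_compl, hdiv]
    rwa [Finset.sum_add_distrib, sum_sum_eq_zero_of_skew S F hskew, zero_add] at h
  rw [← htotal, Finset.sum_eq_single_of_mem x hxS,
    Finset.sum_eq_single_of_mem y (Finset.mem_compl.2 hyS)]
  · intro v hv hne
    exact hcross x hxS v (Finset.mem_compl.1 hv) fun h => hne (Prod.ext_iff.1 h).2
  · intro u hu hne
    refine Finset.sum_eq_zero fun v hv => ?_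
    exact hcross u hu v (Finset.mem_compl.1 hv) fun h => hne (Prod.ext_iff.1 h).1

/-- On a finite tree carrying a nowhere vanishing `lam`-eigenfunction, a function vanishing at `o`
and satisfying the eigenvalue equation away from `o` is zero. -/
theorem SimpleGraph.IsTree.eq_zero_of_eigen_off {V : Type*} [Fintype V] {G : SimpleGraph V}
    [DecidableRel G.Adj] (hG : G.IsTree) {lam : ℝ} {φ f : V → ℝ} (hφ : ∀ v, φ v ≠ 0)
    (hφA : G.adjMatrix ℝ *ᵥ φ = lam • φ) {o : V} (ho : f o = 0)
    (hf : ∀ u, u ≠ o → (G.adjMatrix ℝ *ᵥ f) u = lam * f u) : f = 0 := by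
  let F : V → V → ℝ := fun u v => G.adjMatrix ℝ u v * (f u * φ v - f v * φ u)
  have hskew : ∀ u v, F u v = -F v u := fun u v => by
    simp only [F, SimpleGraph.adjMatrix_apply, G.adj_comm u v]
    ring
  have hsum : ∀ u, ∑ v, F u v
      = f u * (G.adjMatrix ℝ *ᵥ φ) u - φ u * (G.adjMatrix ℝ *ᵥ f) u := fun u => by
    simp only [F, Matrix.mulVec, dotProduct, Finset.mul_sum, ← Finset.sum_sub_distrib]
    exact Finset.sum_congr rfl fun v _ => by ring
  have hdiv_off : ∀ u, u ≠ o → ∑ v, F u v = 0 := fun u hu => by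
    rw [hsum, hφA, hf u hu, Pi.smul_apply, smul_eq_mul]
    ring
  have hdiv : ∀ u, ∑ v, F u v = 0 := fun u => by
    by_cases hu : u = o
    · subst hu
      rw [← sum_sum_eq_zero_of_skew Finset.univ F hskew]
      exact (Finset.sum_eq_single_of_mem u (Finset.mem_univ u) fun w _ hw => hdiv_off w hw).symm
    · exact hdiv_off u hu
  have hstep : ∀ u v, G.Adj u v → f u = 0 → f v = 0 := fun u v huv hu => by
    have h := hG.isAcyclic.flow_eq_zero hskew
      (fun a b hab => by simp [F, SimpleGraph.adjMatrix_apply, hab]) hdiv u v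
    simpa [F, SimpleGraph.adjMatrix_apply, huv, hu, hφ u] using h
  funext v
  obtain ⟨p⟩ := hG.connected.preconnected o v
  clear hf hdiv_off
  induction p with
  | nil => exact ho
  | cons h _ ih => exact ih (hstep _ _ h ho)

/-- If `f` vanishes at `o`, the adjacency matrix of the graph with `o` deleted acts on the
restriction of `f` as the full adjacency matrix acts on `f`. -/
theorem SimpleGraph.adjMatrix_induce_ne_mulVec {V : Type*} [Fintype V] [DecidableEq V]
    (G : SimpleGraph V) [DecidableRel G.Adj] {o : V} {f : V → ℝ} (ho : f o = 0)
    (u : ↥{v : V | v ≠ o}) :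
    ((G.induce {v : V | v ≠ o}).adjMatrix ℝ *ᵥ fun v => f v) u = (G.adjMatrix ℝ *ᵥ f) u := by
  simp only [Matrix.mulVec, dotProduct, SimpleGraph.adjMatrix_apply, SimpleGraph.comap_adj,
    Function.Embedding.subtype_apply]
  rw [← Finset.sum_erase Finset.univ (a := o) (by rw [ho, mul_zero])]
  exact (Finset.sum_subtype (Finset.univ.erase o) (p := fun v => v ∈ {v : V | v ≠ o})
    (fun v => by simp) (fun v => (if G.Adj u v then (1 : ℝ) else 0) * f v)).symm

/-- For a finite tree `T` with adjacency matrix `A` and `λ ∈ ℝ`, the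
following are equivalent: (i) there is `φ : V → ℝ` nowhere vanishing with `Aφ = λφ`;
(ii) `λ` is an eigenvalue of `A` but, for every vertex `o`, not an eigenvalue of the
adjacency matrix of the subgraph induced on `V \ {o}` (i.e. `T` is `λ`-prime). -/
theorem stmt_3 {V : Type*} [Fintype V] [DecidableEq V]
    (G : SimpleGraph V) [DecidableRel G.Adj] (hG : G.IsTree) (lam : ℝ) :
    (∃ φ : V → ℝ, (∀ o : V, φ o ≠ 0) ∧ G.adjMatrix ℝ *ᵥ φ = lam • φ)
    ↔ ((∃ ψ : V → ℝ, ψ ≠ 0 ∧ G.adjMatrix ℝ *ᵥ ψ = lam • ψ) ∧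
        ∀ o : V, ¬ ∃ ψ : ↥{v : V | v ≠ o} → ℝ, ψ ≠ 0 ∧
          (G.induce {v : V | v ≠ o}).adjMatrix ℝ *ᵥ ψ = lam • ψ) := by
  constructor
  · rintro ⟨φ, hφ, hφA⟩
    obtain ⟨v₀⟩ := hG.connected.nonempty
    refine ⟨⟨φ, fun h => hφ v₀ (congrFun h v₀), hφA⟩, ?_⟩
    rintro o ⟨ψ, hψ, hψA⟩
    let f : V → ℝ := fun v => if h : v ≠ o then ψ ⟨v, h⟩ else 0
    have ho : f o = 0 := by simp [f]
    have hfψ : (fun v : ↥{v : V | v ≠ o} => f v) = ψ := funext fun v => dif_pos v.2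
    have hf : f = 0 := hG.eq_zero_of_eigen_off hφ hφA ho fun u hu => by
      rw [← G.adjMatrix_induce_ne_mulVec ho ⟨u, hu⟩, hfψ, hψA, ← hfψ]
      rfl
    exact hψ (by rw [← hfψ, hf]; rfl)
  · rintro ⟨⟨ψ, hψ, hψA⟩, hprime⟩
    refine ⟨ψ, fun o ho => hprime o ⟨fun v => ψ v, fun h => hψ ?_, ?_⟩, hψA⟩
    · funext v
      by_cases hv : v = o
      · rw [hv, ho, Pi.zero_apply]
      · exact congrFun h ⟨v, hv⟩
    · funext u
      rw [G.adjMatrix_induce_ne_mulVec ho u, hψA]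
      rfl
end

section
/- Let T be a finite tree with vertex set V and adjacency matrix A, let λ ∈ ℝ, and let φ : V → ℝ satisfy φ(x) ≠ 0 for all x ∈ V and Aφ = λφ. Let {o, o'} be an edge of T and let C be the vertex set of the connected component of o in the subgraph induced on V ∖ {o'}. If ψ : C → ℝ satisfies Σ_{y ∈ C, y adjacent to x} ψ(y) = λ·ψ(x) for every x ∈ C with x ≠ o, then there exists κ ∈ ℝ such that ψ(x) = κ·φ(x) for all x ∈ C. -/
open Classical Matrix

namespace SimpleGraph

variable {V : Type*} {G : SimpleGraph V}

/-- In a tree, a vertex has at most one neighbour closer to a given root. -/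
lemma IsTree.eq_of_adj_of_dist_succ_eq (hG : G.IsTree) {o x y z : V}
    (hy : G.Adj x y) (hz : G.Adj x z)
    (hdy : G.dist x o = G.dist y o + 1) (hdz : G.dist x o = G.dist z o + 1) : y = z := by
  obtain ⟨p, hp⟩ := hG.connected.exists_walk_length_eq_dist y o
  obtain ⟨q, hq⟩ := hG.connected.exists_walk_length_eq_dist z o
  have hcp : (Walk.cons hy p).IsPath :=
    Walk.isPath_of_length_eq_dist _ (by rw [Walk.length_cons, hp, hdy])
  have hcq : (Walk.cons hz q).IsPath :=
    Walk.isPath_of_length_eq_dist _ (by rw [Walk.length_cons, hq, hdz])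
  simpa using congrArg Walk.snd ((hG.existsUnique_path x o).unique hcp hcq)

/-- In a tree with edge `{o, o'}`, a vertex other than `o` joined to `o` by a walk avoiding `o'`
is not adjacent to `o'`. -/
lemma IsTree.not_adj_of_walk_avoiding (hG : G.IsTree) {o o' x : V} (hoo' : G.Adj o o')
    (p : G.Walk x o) (hp : o' ∉ p.support) (hx : x ≠ o) : ¬ G.Adj x o' := by
  intro hadj
  have hpath : (Walk.cons hadj (Walk.cons hoo'.symm Walk.nil)).IsPath := by
    simp [Walk.cons_isPath_iff, hadj.ne, hx, hoo'.ne']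
  have heq := (hG.existsUnique_path x o).unique p.bypass_isPath hpath
  apply hp
  apply p.support_bypass_subset_support
  simp [heq]

/-- An antisymmetric flow on a finite tree that is conserved away from the root `o` vanishes
on every edge within a set `C` containing all neighbours of its non-root members. -/
lemma IsTree.flow_eq_zero [Fintype V] (hG : G.IsTree) {o : V} {C : Set V} {w : V → V → ℝ}
    (hw : ∀ x y, w x y = -w y x)
    (hC : ∀ x ∈ C, x ≠ o → ∀ y, G.Adj x y → y ∈ C)
    (hdiv : ∀ x ∈ C, x ≠ o → ∑ y ∈ G.neighborFinset x, w x y = 0)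
    {x y : V} (hx : x ∈ C) (hy : y ∈ C) (hxy : G.Adj x y) : w x y = 0 := by
  have dist_adj : ∀ {a b : V}, G.Adj a b →
      G.dist a o = G.dist b o + 1 ∨ G.dist b o = G.dist a o + 1 := fun h => by
    simpa only [dist_comm] using hG.dist_eq_dist_add_one_of_adj o h
  let N := Finset.univ.sup fun v => G.dist v o
  have hN : ∀ v, G.dist v o ≤ N := fun v =>
    Finset.le_sup (f := fun v => G.dist v o) (Finset.mem_univ v)
  have toward_root : ∀ n : ℕ, ∀ a ∈ C, N - G.dist a o = n → ∀ b, G.Adj a b →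
      G.dist a o = G.dist b o + 1 → w a b = 0 := by
    intro n
    induction n using Nat.strong_induction_on with
    | _ n ih =>
      intro a ha hn b hab hd
      have hao : a ≠ o := by
        rintro rfl
        simp at hd
      rw [← hdiv a ha hao]
      refine (Finset.sum_eq_single_of_mem b (by simpa using hab) fun c hc hcb => ?_).symm
      have hac : G.Adj a c := by simpa using hc
      rcases dist_adj hac with h | h
      · exact absurd (hG.eq_of_adj_of_dist_succ_eq hac hab h hd) hcb
      · have := hN c
        rw [hw, ih (N - G.dist c o) (by omega) c (hC a ha hao c hac) rfl a hac.symm h, neg_zero]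
  rcases dist_adj hxy with h | h
  · exact toward_root _ x hx rfl y hxy h
  · rw [hw, toward_root _ y hy rfl x hxy.symm h, neg_zero]

end SimpleGraph

/-- Let `T` be a finite tree, `λ ∈ ℝ`, and `φ` a nowhere-vanishing
`λ`-eigenfunction. Let `{o, o'}` be an edge of `T` and `C` the vertex set of the connected
component of `o` in the subgraph induced on `V \ {o'}` (equivalently, the set of vertices
that can be joined to `o` by a walk avoiding `o'`). If `ψ` satisfies the `λ`-eigenvalue
equation on `C` at every vertex except possibly `o`, then `ψ` is proportional to `φ` on `C`. -/
theorem stmt_5 {V : Type*} [Fintype V] [DecidableEq V]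
    (G : SimpleGraph V) [DecidableRel G.Adj] (hG : G.IsTree) (lam : ℝ)
    (φ : V → ℝ) (hφ : ∀ x : V, φ x ≠ 0)
    (heig : G.adjMatrix ℝ *ᵥ φ = lam • φ)
    (o o' : V) (hoo' : G.Adj o o')
    (C : Set V) (hC : C = {v : V | ∃ p : G.Walk v o, o' ∉ p.support})
    (ψ : V → ℝ)
    (hψ : ∀ x ∈ C, x ≠ o →
      (∑ y : V, if y ∈ C ∧ G.Adj x y then ψ y else 0) = lam * ψ x) :
    ∃ κ : ℝ, ∀ x ∈ C, ψ x = κ * φ x := by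
  have hclosed : ∀ x ∈ C, ∀ y, G.Adj x y → y ≠ o' → y ∈ C := by
    intro x hx y hxy hy
    rw [hC] at hx ⊢
    obtain ⟨p, hp⟩ := hx
    exact ⟨SimpleGraph.Walk.cons hxy.symm p, by simp [hp, hy.symm]⟩
  have hnbr : ∀ x ∈ C, x ≠ o → ∀ y, G.Adj x y → y ∈ C := by
    intro x hx hxo y hxy
    refine hclosed x hx y hxy ?_
    rintro rfl
    rw [hC] at hx
    obtain ⟨p, hp⟩ := hx
    exact hG.not_adj_of_walk_avoiding hoo' p hp hxo hxy
  have hdiv : ∀ x ∈ C, x ≠ o →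
      ∑ y ∈ G.neighborFinset x, (φ x * ψ y - ψ x * φ y) = 0 := by
    intro x hx hxo
    have hφx : ∑ y ∈ G.neighborFinset x, φ y = lam * φ x := by
      simpa [SimpleGraph.adjMatrix_mulVec_apply] using congrFun heig x
    have hψx : ∑ y ∈ G.neighborFinset x, ψ y = lam * ψ x := by
      rw [← hψ x hx hxo, ← Finset.sum_filter]
      refine Finset.sum_congr ?_ fun _ _ => rfl
      ext y
      simpa using hnbr x hx hxo y
    rw [Finset.sum_sub_distrib, ← Finset.mul_sum, ← Finset.mul_sum, hφx, hψx]
    ring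
  have hedge : ∀ {x y}, x ∈ C → y ∈ C → G.Adj x y → φ x * ψ y - ψ x * φ y = 0 :=
    fun hx hy hxy => hG.flow_eq_zero (w := fun x y => φ x * ψ y - ψ x * φ y)
      (fun _ _ => by ring) hnbr (fun x hx hxo => by convert hdiv x hx hxo) hx hy hxy
  refine ⟨ψ o / φ o, fun x hx => ?_⟩
  have hwalk : ∀ {u v : V} (p : G.Walk u v), o' ∉ p.support → u ∈ C →
      ψ u = ψ v / φ v * φ u := by
    intro u v p
    induction p with
    | nil => exact fun _ _ => (div_mul_cancel₀ _ (hφ _)).symm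
    | @cons a b c hab q ih =>
      intro hp ha
      rw [SimpleGraph.Walk.support_cons, List.mem_cons, not_or] at hp
      have hb : b ∈ C := hclosed a ha b hab fun h => hp.2 (h ▸ q.start_mem_support)
      have hab' := hedge ha hb hab
      rw [ih hp.2 hb] at hab'
      apply mul_right_cancel₀ (hφ b)
      linear_combination -hab'
  have hx' := hx
  rw [hC] at hx'
  obtain ⟨p, hp⟩ := hx'
  exact hwalk p hp hx
end

section
/- Let T be a finite tree with vertex set V and adjacency matrix A, let o ∈ V, and let z ∈ ℂ with Im z > 0. Let A' denote the adjacency matrix of the subgraph induced on V ∖ {o}. Then A − zI and A' − zI are invertible, and the diagonal resolvent entry at o satisfies ((A − zI)^{−1})_{oo} = −1 / ( z + Σ_{x adjacent to o} ((A' − zI)^{−1})_{xx} ). -/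
open Classical Matrix

/-- Schur complement formula for a diagonal entry of the inverse matrix. -/
theorem Matrix.schur_complement_mul_inv_apply {V R : Type*} [Fintype V] [DecidableEq V]
    [CommRing R] (o : V) [Fintype {v : V | v ≠ o}] [DecidableEq {v : V | v ≠ o}]
    (B : Matrix V V R) (hB : IsUnit B)
    (C : Matrix {v : V | v ≠ o} {v : V | v ≠ o} R) (hC : IsUnit C)
    (hBC : ∀ x y, C x y = B x y) :
    (B o o - ∑ x : ↥{v : V | v ≠ o}, B o x * ∑ y : ↥{v : V | v ≠ o}, C⁻¹ x y * B y o) *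
      B⁻¹ o o = 1 := by
  set w : {v : V | v ≠ o} → R := C⁻¹ *ᵥ fun y : ↥{v : V | v ≠ o} => B y o with hw
  have hCw : C *ᵥ w = fun y : ↥{v : V | v ≠ o} => B y o := by
    rw [hw, mulVec_mulVec, mul_nonsing_inv _ ((isUnit_iff_isUnit_det _).mp hC), one_mulVec]
  set u : V → R := fun v => if h : v = o then 1 else -w ⟨v, h⟩ with hu
  have hsum (v : V) : (B *ᵥ u) v = B v o - ∑ x : ↥{v : V | v ≠ o}, B v x * w x := by
    have h := Fintype.sum_eq_add_sum_subtype_ne (fun x => B v x * u x) o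
    have h' : ∑ x : ↥{v : V | v ≠ o}, B v x * u x = -∑ x : ↥{v : V | v ≠ o}, B v x * w x := by
      rw [← Finset.sum_neg_distrib]
      exact Finset.sum_congr rfl fun x _ => by simp [hu, show (x : V) ≠ o from x.2]
    have ho : u o = 1 := by simp [hu]
    rw [mulVec, dotProduct, sub_eq_add_neg, ← h', ← mul_one (B v o), ← ho]
    convert h
  set d := B o o - ∑ x : ↥{v : V | v ≠ o}, B o x * w x with hd
  have hBu : B *ᵥ u = Pi.single o d := by
    ext v
    rw [hsum]
    by_cases hv : v = o
    · subst hv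
      simp [hd]
    · have h := congrFun hCw ⟨v, hv⟩
      simp only [mulVec, dotProduct, hBC] at h
      rw [h]
      simp [hv]
  have huo : u = B⁻¹ *ᵥ Pi.single o d := by
    rw [← hBu, mulVec_mulVec, nonsing_inv_mul _ ((isUnit_iff_isUnit_det _).mp hB), one_mulVec]
  have h := congrFun huo o
  simp only [mulVec_single] at h
  rw [hu] at h
  simpa [hd, hw, mulVec, dotProduct, mul_comm] using h.symm

open scoped ComplexOrder in
/-- A Hermitian matrix minus a non-real scalar is invertible. -/
theorem Matrix.IsHermitian.isUnit_sub_smul_one {n : Type*} [Fintype n] [DecidableEq n]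
    {A : Matrix n n ℂ} (hA : A.IsHermitian) {z : ℂ} (hz : z.im ≠ 0) :
    IsUnit (A - z • 1) := by
  rw [isUnit_iff_isUnit_det, isUnit_iff_ne_zero]
  intro hdet
  obtain ⟨v, hv, hAv⟩ := exists_mulVec_eq_zero_iff.mpr hdet
  have hAz : A *ᵥ v = z • v := by
    rwa [sub_mulVec, smul_mulVec, one_mulVec, sub_eq_zero] at hAv
  have him := hA.im_star_dotProduct_mulVec_self v
  have hnorm : 0 < star v ⬝ᵥ v := dotProduct_star_self_pos_iff.mpr hv
  rw [hAz, dotProduct_smul, smul_eq_mul] at him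
  obtain ⟨hre, hi⟩ := Complex.lt_def.mp hnorm
  simp only [Complex.zero_re, Complex.zero_im] at hre hi
  simp [← hi, hz, hre.ne'] at him

/-- The resolvent of the adjacency matrix vanishes between distinct components. -/
theorem SimpleGraph.inv_adjMatrix_sub_smul_one_apply_of_not_reachable {W R : Type*} [Fintype W]
    [DecidableEq W] [CommRing R] (H : SimpleGraph W) [DecidableRel H.Adj] (z : R)
    {x y : W} (hxy : ¬ H.Reachable x y) : (H.adjMatrix R - z • 1)⁻¹ x y = 0 := by
  set P : Matrix W W R := diagonal fun v => if H.Reachable x v then 1 else 0 with hP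
  have hcomm : Commute (H.adjMatrix R) P := by
    ext a b
    rw [hP, mul_diagonal, diagonal_mul, adjMatrix_apply]
    by_cases hab : H.Adj a b
    · have hiff : H.Reachable x a ↔ H.Reachable x b :=
        ⟨fun h => h.trans hab.reachable, fun h => h.trans hab.symm.reachable⟩
      simp [hab, hiff]
    · simp [hab]
  have hcomm' : Commute (H.adjMatrix R - z • 1)⁻¹ P := by
    have h := Matrix.Commute.zpow_left (hcomm.sub_left ((Commute.one_left P).smul_left z)) (-1)
    rwa [Matrix.zpow_neg_one] at h
  have h := congrFun (congrFun hcomm'.eq x) y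
  rw [hP, mul_diagonal, diagonal_mul] at h
  simpa [hxy] using h.symm

/-- Deleting a vertex of a forest separates its neighbours. -/
theorem SimpleGraph.IsAcyclic.not_reachable_induce_ne {V : Type*} {G : SimpleGraph V}
    (hG : G.IsAcyclic) {o : V} {x y : {v : V | v ≠ o}} (hx : G.Adj o x) (hy : G.Adj o y)
    (hxy : x ≠ y) : ¬ (G.induce {v : V | v ≠ o}).Reachable x y := by
  intro h
  have hb := isAcyclic_iff_forall_adj_isBridge.mp hG hx
  rw [isBridge_iff] at hb
  let f : G.induce {v : V | v ≠ o} →g G.deleteEdges {s(o, (x : V))} :=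
    ⟨Subtype.val, fun {a b} hab => by
      have ha := a.2
      have hb := b.2
      simp only [Set.mem_ofPred_eq] at ha hb
      simp_all [deleteEdges_adj, Ne.symm]⟩
  have hoy : (G.deleteEdges {s(o, (x : V))}).Adj o y := by
    have h1 := x.2
    have h2 : (y : V) ≠ x := fun h => hxy (Subtype.ext h.symm)
    simp_all [deleteEdges_adj]
  exact hb (hoy.reachable.trans (h.map f).symm)

/-- Let `T` be a finite tree with (complex) adjacency matrix `A`, `o` a
vertex, and `z ∈ ℂ` with `Im z > 0`. Let `A'` be the adjacency matrix of the subgraph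
induced on `V \ {o}`. Then `A - zI` and `A' - zI` are invertible and
`((A - zI)⁻¹)_{oo} = -1 / (z + ∑_{x ~ o} ((A' - zI)⁻¹)_{xx})`. -/
theorem stmt_6 {V : Type*} [Fintype V] [DecidableEq V]
    (G : SimpleGraph V) [DecidableRel G.Adj] (hG : G.IsTree)
    (o : V) (z : ℂ) (hz : 0 < z.im)
    (A' : Matrix ↥{v : V | v ≠ o} ↥{v : V | v ≠ o} ℂ)
    (hA' : A' = (G.induce {v : V | v ≠ o}).adjMatrix ℂ) :
    IsUnit (G.adjMatrix ℂ - z • 1) ∧ IsUnit (A' - z • 1) ∧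
    (G.adjMatrix ℂ - z • 1)⁻¹ o o
      = -1 / (z + ∑ x : ↥{v : V | v ≠ o},
          if G.Adj o ↑x then (A' - z • 1)⁻¹ x x else 0) := by
  have hH : A'.IsHermitian := by
    ext a b
    simp [hA', SimpleGraph.adjMatrix_apply, SimpleGraph.adj_comm, apply_ite]
  have hB : IsUnit (G.adjMatrix ℂ - z • 1) := by
    refine IsHermitian.isUnit_sub_smul_one ?_ hz.ne'
    ext a b
    simp [SimpleGraph.adjMatrix_apply, SimpleGraph.adj_comm, apply_ite]
  have hC : IsUnit (A' - z • 1) := hH.isUnit_sub_smul_one hz.ne'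
  refine ⟨hB, hC, ?_⟩
  have key := schur_complement_mul_inv_apply o _ hB _ hC fun x y => by
    simp [hA', SimpleGraph.adjMatrix_apply, one_apply, Subtype.ext_iff]
  have hsum (x : ↥{v : V | v ≠ o}) : (G.adjMatrix ℂ - z • 1) o x *
      ∑ y : ↥{v : V | v ≠ o}, (A' - z • 1)⁻¹ x y * (G.adjMatrix ℂ - z • 1) y o =
      if G.Adj o x then (A' - z • 1)⁻¹ x x else 0 := by
    by_cases hx : G.Adj o x
    · rw [Finset.sum_eq_single x]
      · simp [hx, hx.symm, one_apply, hx.ne, hx.ne']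
      · intro y _ hyx
        by_cases hy : G.Adj o y
        · have h0 : (A' - z • 1)⁻¹ x y = 0 := by
            rw [hA']
            exact SimpleGraph.inv_adjMatrix_sub_smul_one_apply_of_not_reachable _ z
              (hG.isAcyclic.not_reachable_induce_ne hx hy hyx.symm)
          rw [h0, zero_mul]
        · simp [one_apply, show (y : V) ≠ o from y.2, G.adj_comm y o, hy]
      · simp
    · simp [hx, one_apply, x.2.symm]
  rw [Finset.sum_congr rfl fun x _ => hsum x] at key
  have hoo : (G.adjMatrix ℂ - z • 1) o o = -z := by simp
  rw [hoo] at key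
  rw [eq_div_iff fun h => ?_]
  · linear_combination -key
  · rw [← neg_add', h] at key
    simp at key
end

section
/- Let T be a finite tree with vertex set V and adjacency matrix A. If there exists φ : V → ℝ with φ(o) ≠ 0 for every o ∈ V and Aφ = 0, then T consists of a single vertex, i.e., |V| = 1. -/
open Matrix

/-- If a finite tree `T` with adjacency matrix `A` admits a nowhere-vanishing
function `φ : V → ℝ` with `Aφ = 0`, then `T` consists of a single vertex. -/
theorem stmt_7 {V : Type*} [Fintype V] [DecidableEq V]
    (G : SimpleGraph V) [DecidableRel G.Adj] (hG : G.IsTree)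
    (φ : V → ℝ) (hφ : ∀ o : V, φ o ≠ 0)
    (h : G.adjMatrix ℝ *ᵥ φ = 0) :
    Fintype.card V = 1 := by
  have : Nonempty V := hG.connected.nonempty
  rcases subsingleton_or_nontrivial V with _ | _
  · exact Fintype.card_eq_one_iff_nonempty_unique.mpr (nonempty_unique V)
  · obtain ⟨v, hv⟩ := hG.exists_vert_degree_one_of_nontrivial
    obtain ⟨w, hw⟩ := Finset.card_eq_one.mp ((G.card_neighborFinset_eq_degree v).trans hv)
    have hv0 := congrFun h v
    rw [SimpleGraph.adjMatrix_mulVec_apply, hw, Finset.sum_singleton] at hv0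
    exact absurd hv0 (hφ w)
end

section
/- Let μ be a finite Borel measure on ℝ with Stieltjes transform s_μ. Then for every z in the upper half-plane ℍ one has Im(z + s_μ(z)) > 0 (so z + s_μ(z) ≠ 0), and there exists a unique Borel probability measure ν on ℝ such that s_ν(z) = −1/(z + s_μ(z)) for all z ∈ ℍ. -/
open MeasureTheory

open Filter Topology
open scoped BoundedContinuousFunction InnerProductSpace

lemma ofReal_sub_ne_zero {z : ℂ} (hz : 0 < z.im) (x : ℝ) : (x : ℂ) - z ≠ 0 := by
  intro h
  have := congrArg Complex.im h
  simp at this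
  exact hz.ne' this

lemma norm_inv_ofReal_sub_le {z : ℂ} (hz : 0 < z.im) (x : ℝ) :
    ‖((x : ℂ) - z)⁻¹‖ ≤ z.im⁻¹ := by
  rw [norm_inv]
  apply inv_anti₀ hz
  have := Complex.abs_im_le_norm ((x : ℂ) - z)
  simpa [abs_of_pos hz] using this

lemma continuous_inv_ofReal_sub {z : ℂ} (hz : 0 < z.im) :
    Continuous fun x : ℝ => ((x : ℂ) - z)⁻¹ :=
  (Complex.continuous_ofReal.sub continuous_const).inv₀ (ofReal_sub_ne_zero hz)

lemma integrable_inv_ofReal_sub (μ : Measure ℝ) [IsFiniteMeasure μ] {z : ℂ} (hz : 0 < z.im) :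
    Integrable (fun x : ℝ => ((x : ℂ) - z)⁻¹) μ :=
  .of_bound (continuous_inv_ofReal_sub hz).aestronglyMeasurable z.im⁻¹
    (.of_forall (norm_inv_ofReal_sub_le hz))

lemma im_inv_ofReal_sub (z : ℂ) (x : ℝ) :
    (((x : ℂ) - z)⁻¹).im = z.im / ((x - z.re) ^ 2 + z.im ^ 2) := by
  simp [Complex.inv_im, Complex.normSq_apply, pow_two]

lemma im_integral_inv_ofReal_sub (μ : Measure ℝ) [IsFiniteMeasure μ] {z : ℂ} (hz : 0 < z.im) :
    (∫ x : ℝ, ((x : ℂ) - z)⁻¹ ∂μ).im = ∫ x : ℝ, z.im / ((x - z.re) ^ 2 + z.im ^ 2) ∂μ := by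
  simp_rw [← im_inv_ofReal_sub]
  exact (Complex.imCLM.integral_comp_comm (integrable_inv_ofReal_sub μ hz)).symm

lemma im_integral_inv_ofReal_sub_nonneg (μ : Measure ℝ) [IsFiniteMeasure μ] {z : ℂ}
    (hz : 0 < z.im) : 0 ≤ (∫ x : ℝ, ((x : ℂ) - z)⁻¹ ∂μ).im := by
  rw [im_integral_inv_ofReal_sub μ hz]
  exact integral_nonneg fun x => by positivity

lemma norm_integral_inv_ofReal_sub_le (μ : Measure ℝ) [IsFiniteMeasure μ] {z : ℂ}
    (hz : 0 < z.im) : ‖∫ x : ℝ, ((x : ℂ) - z)⁻¹ ∂μ‖ ≤ μ.real Set.univ / z.im := by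
  rw [div_eq_inv_mul]
  exact norm_integral_le_of_norm_le_const (.of_forall (norm_inv_ofReal_sub_le hz))

/-- The spectral measure of a symmetric operator on a finite-dimensional space at a unit vector. -/
lemma LinearMap.IsSymmetric.exists_isProbabilityMeasure_integral_inv_sub_eq_inner
    {E : Type*} [NormedAddCommGroup E] [InnerProductSpace ℂ E] [FiniteDimensional ℂ E]
    {T : E →ₗ[ℂ] E} (hT : T.IsSymmetric) {e : E} (he : ‖e‖ = 1) :
    ∃ ν : Measure ℝ, IsProbabilityMeasure ν ∧ ∀ z : ℂ, 0 < z.im → ∀ v : E, T v - z • v = e →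
      ∫ x : ℝ, ((x : ℂ) - z)⁻¹ ∂ν = ⟪e, v⟫_ℂ := by
  set b := hT.eigenvectorBasis rfl
  set l := hT.eigenvalues rfl
  have hsum : ∑ i, ‖⟪b i, e⟫_ℂ‖ ^ 2 = 1 := by rw [b.sum_sq_norm_inner_right, he, one_pow]
  refine ⟨∑ i, ENNReal.ofReal (‖⟪b i, e⟫_ℂ‖ ^ 2) • Measure.dirac (l i), ⟨?_⟩, fun z hz v hv => ?_⟩
  · simp only [Measure.coe_finsetSum, Finset.sum_apply, Measure.smul_apply, measure_univ,
      smul_eq_mul, mul_one]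
    rw [← ENNReal.ofReal_sum_of_nonneg (fun i _ => by positivity), hsum, ENNReal.ofReal_one]
  · rw [integral_finsetSum_measure, ← b.sum_inner_mul_inner e v]
    · refine Finset.sum_congr rfl fun i _ => ?_
      have h1 : ⟪b i, e⟫_ℂ = ((l i : ℂ) - z) * ⟪b i, v⟫_ℂ := by
        have h2 := hT.eigenvectorBasis_apply_self_apply rfl v i
        simp only [OrthonormalBasis.repr_apply_apply] at h2
        rw [← hv, inner_sub_right, inner_smul_right, sub_mul]
        exact congrArg (· - _) h2
      have hne := ofReal_sub_ne_zero hz (l i)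
      rw [integral_smul_measure, integral_dirac, ENNReal.toReal_ofReal (by positivity),
        Complex.real_smul, ← inner_conj_symm e (b i)]
      push_cast
      rw [← Complex.conj_mul', mul_assoc]
      congr 1
      rw [h1]
      field_simp
    · intro i _
      exact (integrable_dirac (by simp)).smul_measure ENNReal.ofReal_ne_top

/-- For finitely many atoms, the negative reciprocal of `z + s(z)` is the corner entry of the
resolvent of a bordered diagonal matrix, hence the Stieltjes transform of a spectral measure. -/
lemma exists_isProbabilityMeasure_integral_inv_sub_eq_of_sum {ι : Type*} [Fintype ι]
    (w : ι → ℝ) (hw : ∀ i, 0 ≤ w i) (x : ι → ℝ) :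
    ∃ ν : Measure ℝ, IsProbabilityMeasure ν ∧ ∀ z : ℂ, 0 < z.im →
      z + ∑ i, w i • ((x i : ℂ) - z)⁻¹ ≠ 0 →
      ∫ t : ℝ, ((t : ℂ) - z)⁻¹ ∂ν = -1 / (z + ∑ i, w i • ((x i : ℂ) - z)⁻¹) := by
  classical
  let A : Matrix (Option ι) (Option ι) ℂ := Matrix.of fun i j => match i, j with
    | none, none => 0
    | none, some j => (√(w j) : ℂ)
    | some i, none => (√(w i) : ℂ)
    | some i, some j => if i = j then (x i : ℂ) else 0
  have hA : A.IsHermitian := by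
    ext i j
    rcases i with _ | i <;> rcases j with _ | j <;> simp [A, Matrix.conjTranspose_apply]
    by_cases h : i = j
    · simp [h]
    · simp [h, Ne.symm h]
  obtain ⟨ν, hν, H⟩ :=
    (Matrix.isSymmetric_toEuclideanLin_iff.2 hA)
      |>.exists_isProbabilityMeasure_integral_inv_sub_eq_inner
      (e := EuclideanSpace.single none 1) (by simp)
  refine ⟨ν, hν, fun z hz h0 => ?_⟩
  set G : ℂ := -1 / (z + ∑ i, w i • ((x i : ℂ) - z)⁻¹)
  rw [H z hz (WithLp.toLp 2 fun i => match i with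
    | none => G
    | some i => -(√(w i) : ℂ) * G * ((x i : ℂ) - z)⁻¹)]
  · simp [EuclideanSpace.inner_single_left]
  · ext i
    rcases i with _ | i
    · have h2 : G * (z + ∑ i, w i • ((x i : ℂ) - z)⁻¹) = -1 := div_mul_cancel₀ _ h0
      have h3 : ∀ i, (√(w i) : ℂ) * (√(w i) * G * ((x i : ℂ) - z)⁻¹)
          = G * (w i • ((x i : ℂ) - z)⁻¹) := fun i => by
        have : (√(w i) : ℂ) * √(w i) = w i := by
          exact_mod_cast Real.mul_self_sqrt (hw i)
        rw [Complex.real_smul, ← this]; ring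
      simp [A, Matrix.toLpLin_apply, Matrix.mulVec, dotProduct, Fintype.sum_option]
      simp only [h3, ← Finset.mul_sum]
      linear_combination -h2
    · have hne := ofReal_sub_ne_zero hz (x i)
      simp [A, Matrix.toLpLin_apply, Matrix.mulVec, dotProduct, Fintype.sum_option]
      field_simp
      ring

lemma integral_comp_add_mul_inv_one_add_sq (f : ℝ → ℝ) (ξ : ℝ) {ε : ℝ} (hε : 0 < ε) :
    ∫ t, f (ξ + ε * t) * (1 + t ^ 2)⁻¹ = ∫ x, f x * (ε / ((ξ - x) ^ 2 + ε ^ 2)) := by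
  rw [← integral_add_left_eq_self (fun x => f x * (ε / ((ξ - x) ^ 2 + ε ^ 2))) ξ]
  have h := Measure.integral_comp_mul_left
    (fun x => f (ξ + x) * (ε / ((ξ - (ξ + x)) ^ 2 + ε ^ 2))) ε
  rw [abs_of_pos (inv_pos.2 hε), smul_eq_mul, eq_inv_mul_iff_mul_eq₀ hε.ne',
    ← integral_const_mul] at h
  rw [← h]
  congr 1 with t
  have : (1 : ℝ) + t ^ 2 ≠ 0 := by positivity
  have h2 : (ξ - (ξ + ε * t)) ^ 2 + ε ^ 2 = ε ^ 2 * (1 + t ^ 2) := by ring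
  rw [h2]
  field_simp

/-- Integrating against the Poisson smoothing of a measure is integrating against the
imaginary part of its Stieltjes transform on a horizontal line. -/
lemma integral_integral_comp_add_mul_inv_one_add_sq (ν : Measure ℝ) [IsFiniteMeasure ν]
    (f : ℝ →ᵇ ℝ) {ε : ℝ} (hε : 0 < ε) :
    ∫ ξ, (∫ t, f (ξ + ε * t) * (1 + t ^ 2)⁻¹) ∂ν =
      ∫ x : ℝ, f x * (∫ ξ : ℝ, ((ξ : ℂ) - (x + ε * Complex.I))⁻¹ ∂ν).im := by
  have him (x : ℝ) : (∫ ξ : ℝ, ((ξ : ℂ) - (x + ε * Complex.I))⁻¹ ∂ν).im =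
      ∫ ξ : ℝ, ε / ((ξ - x) ^ 2 + ε ^ 2) ∂ν := by
    rw [im_integral_inv_ofReal_sub ν (by simpa using hε)]
    simp
  have hpos (ξ x : ℝ) : (ξ - x) ^ 2 + ε ^ 2 ≠ 0 := by positivity
  have hcont : Continuous (Function.uncurry fun ξ x : ℝ => ε / ((ξ - x) ^ 2 + ε ^ 2)) :=
    continuous_const.div (by fun_prop) fun p => hpos p.1 p.2
  have hint : Integrable (Function.uncurry fun ξ x : ℝ => ε / ((ξ - x) ^ 2 + ε ^ 2))
      (ν.prod volume) := by
    have hbase (ξ : ℝ) : ∫ x, ε / ((ξ - x) ^ 2 + ε ^ 2) = Real.pi := by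
      simpa using (integral_comp_add_mul_inv_one_add_sq (fun _ => 1) ξ hε).symm
    refine (integrable_prod_iff hcont.aestronglyMeasurable).2 ⟨.of_forall fun ξ => ?_, ?_⟩
    · refine .of_integral_ne_zero ?_
      simp only [Function.uncurry_apply_pair, hbase]
      exact Real.pi_ne_zero
    · have hn (ξ x : ℝ) : ‖ε / ((ξ - x) ^ 2 + ε ^ 2)‖ = ε / ((ξ - x) ^ 2 + ε ^ 2) :=
        Real.norm_of_nonneg (by positivity)
      simp only [Function.uncurry_apply_pair, hn, hbase]
      exact integrable_const _
  simp_rw [him, integral_comp_add_mul_inv_one_add_sq f _ hε, ← integral_const_mul]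
  refine integral_integral_swap ?_
  refine hint.bdd_mul (c := ‖f‖) (f := fun p : ℝ × ℝ => f p.2) ?_
    (.of_forall fun p => f.norm_coe_le_norm _)
  exact (f.continuous.comp continuous_snd).aestronglyMeasurable

lemma tendsto_integral_integral_comp_add_mul_inv_one_add_sq (ν : Measure ℝ) [IsFiniteMeasure ν]
    (f : ℝ →ᵇ ℝ) :
    Tendsto (fun ε : ℝ => ∫ ξ, (∫ t, f (ξ + ε * t) * (1 + t ^ 2)⁻¹) ∂ν) (𝓝[>] 0)
      (𝓝 (∫ ξ, f ξ * Real.pi ∂ν)) := by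
  have hb (ξ ε t : ℝ) : ‖f (ξ + ε * t) * (1 + t ^ 2)⁻¹‖ ≤ ‖f‖ * (1 + t ^ 2)⁻¹ := by
    have h : (0 : ℝ) ≤ (1 + t ^ 2)⁻¹ := by positivity
    rw [norm_mul, Real.norm_of_nonneg h]
    exact mul_le_mul_of_nonneg_right (f.norm_coe_le_norm _) h
  have hbi : Integrable fun t : ℝ => ‖f‖ * (1 + t ^ 2)⁻¹ :=
    integrable_inv_one_add_sq.const_mul _
  have hc : Continuous fun t : ℝ => (1 + t ^ 2)⁻¹ :=
    Continuous.inv₀ (by fun_prop) fun t => by positivity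
  have hm (ε : ℝ) : Continuous (Function.uncurry fun ξ t : ℝ => f (ξ + ε * t) * (1 + t ^ 2)⁻¹) :=
    (f.continuous.comp (by fun_prop)).mul (hc.comp continuous_snd)
  refine tendsto_integral_filter_of_dominated_convergence (fun _ => ‖f‖ * Real.pi)
    (.of_forall fun ε => ?_) (.of_forall fun ε => .of_forall fun ξ => ?_) (integrable_const _)
    (.of_forall fun ξ => ?_)
  · exact (hm ε).stronglyMeasurable.integral_prod_right.aestronglyMeasurable
  · rw [← integral_univ_inv_one_add_sq, ← integral_const_mul]
    exact norm_integral_le_of_norm_le hbi (.of_forall (hb ξ ε))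
  · rw [← integral_univ_inv_one_add_sq, ← integral_const_mul]
    refine tendsto_integral_filter_of_dominated_convergence _
      (.of_forall fun ε => ((hm ε).comp (Continuous.prodMk_right ξ)).aestronglyMeasurable)
      (.of_forall fun ε => .of_forall (hb ξ ε)) hbi (.of_forall fun t => ?_)
    have : Continuous fun ε : ℝ => f (ξ + ε * t) * (1 + t ^ 2)⁻¹ :=
      (f.continuous.comp (by fun_prop)).mul continuous_const
    simpa using (this.tendsto 0).mono_left nhdsWithin_le_nhds

/-- A finite measure on `ℝ` is determined by its Stieltjes transform on the upper half-plane. -/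
lemma ext_of_integral_inv_ofReal_sub_eq {ν ν' : Measure ℝ} [IsFiniteMeasure ν]
    [IsFiniteMeasure ν'] (h : ∀ z : ℂ, 0 < z.im →
      ∫ ξ : ℝ, ((ξ : ℂ) - z)⁻¹ ∂ν = ∫ ξ : ℝ, ((ξ : ℂ) - z)⁻¹ ∂ν') : ν = ν' := by
  refine ext_of_forall_integral_eq_of_IsFiniteMeasure fun f => ?_
  have key := tendsto_nhds_unique_of_eventuallyEq
    (tendsto_integral_integral_comp_add_mul_inv_one_add_sq ν f)
    (tendsto_integral_integral_comp_add_mul_inv_one_add_sq ν' f) ?_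
  · rw [integral_mul_const, integral_mul_const] at key
    exact mul_right_cancel₀ Real.pi_ne_zero key
  · filter_upwards [self_mem_nhdsWithin] with ε (hε : 0 < ε)
    rw [integral_integral_comp_add_mul_inv_one_add_sq ν f hε,
      integral_integral_comp_add_mul_inv_one_add_sq ν' f hε]
    congr 1 with x
    rw [h _ (by simpa using hε)]

lemma im_add_integral_inv_ofReal_sub_pos (μ : Measure ℝ) [IsFiniteMeasure μ] {z : ℂ}
    (hz : 0 < z.im) : 0 < (z + ∫ x : ℝ, ((x : ℂ) - z)⁻¹ ∂μ).im := by
  rw [Complex.add_im]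
  exact add_pos_of_pos_of_nonneg hz (im_integral_inv_ofReal_sub_nonneg μ hz)

lemma add_integral_inv_ofReal_sub_ne_zero (μ : Measure ℝ) [IsFiniteMeasure μ] {z : ℂ}
    (hz : 0 < z.im) : z + ∫ x : ℝ, ((x : ℂ) - z)⁻¹ ∂μ ≠ 0 := fun h => by
  have := im_add_integral_inv_ofReal_sub_pos μ hz
  simp [h] at this

lemma exists_isProbabilityMeasure_integral_inv_sub_eq_of_simpleFunc (μ : Measure ℝ)
    [IsFiniteMeasure μ] (g : SimpleFunc ℝ ℝ) :
    ∃ ν : Measure ℝ, IsProbabilityMeasure ν ∧ ∀ z : ℂ, 0 < z.im →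
      ∫ t : ℝ, ((t : ℂ) - z)⁻¹ ∂ν = -1 / (z + ∫ x : ℝ, ((x : ℂ) - z)⁻¹ ∂(μ.map g)) := by
  obtain ⟨ν, hν, H⟩ := exists_isProbabilityMeasure_integral_inv_sub_eq_of_sum
    (fun y : g.range => μ.real (g ⁻¹' {(y : ℝ)})) (fun _ => measureReal_nonneg) (fun y => y)
  refine ⟨ν, hν, fun z hz => ?_⟩
  have hsum : ∫ x : ℝ, ((x : ℂ) - z)⁻¹ ∂(μ.map g) =
      ∑ y : g.range, μ.real (g ⁻¹' {(y : ℝ)}) • (((y : ℝ) : ℂ) - z)⁻¹ := by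
    rw [integral_map g.measurable.aemeasurable (continuous_inv_ofReal_sub hz).aestronglyMeasurable,
      Finset.sum_coe_sort g.range fun y : ℝ => μ.real (g ⁻¹' {y}) • ((y : ℂ) - z)⁻¹]
    have hpt (x : ℝ) : ((g x : ℂ) - z)⁻¹ =
        ∑ y ∈ g.range, (g ⁻¹' {y}).indicator (fun _ => ((y : ℂ) - z)⁻¹) x := by
      rw [Finset.sum_eq_single (g x)]
      · simp
      · intro y _ hy
        simp [Ne.symm hy]
      · simp
    simp_rw [hpt]
    rw [integral_finsetSum]
    · simp_rw [integral_indicator_const _ (g.measurableSet_fiber _)]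
    · exact fun y _ => (integrable_const _).indicator (g.measurableSet_fiber _)
  have hne := add_integral_inv_ofReal_sub_ne_zero (μ.map g) hz
  rw [hsum] at hne ⊢
  exact H z hz hne

/-- A tail bound for a probability measure whose Stieltjes transform is `-1 / (z + s_μ(z))`. -/
lemma measureReal_compl_closedBall_le {μ ν : Measure ℝ} [IsFiniteMeasure μ]
    [IsProbabilityMeasure ν]
    (h : ∀ z : ℂ, 0 < z.im →
      ∫ ξ : ℝ, ((ξ : ℂ) - z)⁻¹ ∂ν = -1 / (z + ∫ ξ : ℝ, ((ξ : ℂ) - z)⁻¹ ∂μ))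
    {y : ℝ} (hy : 0 < y) :
    ν.real (Metric.closedBall 0 y)ᶜ ≤ 2 * (μ.real Set.univ / y ^ 2) := by
  have hz : 0 < ((y : ℂ) * Complex.I).im := by simpa using hy
  set s := ∫ ξ : ℝ, ((ξ : ℂ) - y * Complex.I)⁻¹ ∂μ with hs
  have hsn : ‖s‖ ≤ μ.real Set.univ / y := by
    simpa using norm_integral_inv_ofReal_sub_le μ hz
  have hden : y ≤ ‖y * Complex.I + s‖ := by
    have h1 := Complex.abs_im_le_norm (y * Complex.I + s)
    have h2 := im_integral_inv_ofReal_sub_nonneg μ hz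
    have h3 := le_abs_self (y * Complex.I + s).im
    simp only [Complex.add_im, Complex.mul_im, Complex.ofReal_re, Complex.I_im, Complex.I_re] at *
    linarith
  have hne : y * Complex.I + s ≠ 0 := add_integral_inv_ofReal_sub_ne_zero μ hz
  have hint : Integrable (fun x : ℝ => y / (x ^ 2 + y ^ 2)) ν := by
    refine (integrable_inv_ofReal_sub ν hz).im.congr (.of_forall fun x => ?_)
    exact (im_inv_ofReal_sub _ x).trans (by simp)
  have hA : ∫ x : ℝ, 2 * (1 - y * (y / (x ^ 2 + y ^ 2))) ∂ν ≤ 2 * (μ.real Set.univ / y ^ 2) := by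
    rw [integral_const_mul, integral_sub (integrable_const _) (hint.const_mul y),
      integral_const_mul]
    have him : ∫ x : ℝ, y / (x ^ 2 + y ^ 2) ∂ν =
        (∫ ξ : ℝ, ((ξ : ℂ) - y * Complex.I)⁻¹ ∂ν).im := by
      rw [im_integral_inv_ofReal_sub ν hz]
      simp
    have hre : 1 - y * (∫ ξ : ℝ, ((ξ : ℂ) - y * Complex.I)⁻¹ ∂ν).im
        = (s / (y * Complex.I + s)).re := by
      have : s / (y * Complex.I + s) = 1 + y * Complex.I * (-1 / (y * Complex.I + s)) := by
        field_simp
        ring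
      rw [this, h _ hz, ← hs]
      simp [mul_assoc, sub_eq_add_neg]
    have hle : (s / (y * Complex.I + s)).re ≤ μ.real Set.univ / y ^ 2 := by
      refine (Complex.re_le_norm _).trans ?_
      rw [norm_div, pow_two, ← div_div]
      gcongr
    simp only [integral_const, probReal_univ, one_smul, him, hre]
    gcongr
  refine le_trans ?_ hA
  rw [← integral_indicator_one Metric.isClosed_closedBall.measurableSet.compl]
  refine integral_mono ((integrable_const _).indicator
    Metric.isClosed_closedBall.measurableSet.compl)
    (((integrable_const _).sub (hint.const_mul y)).const_mul 2) fun x => ?_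
  have hpos : 0 < x ^ 2 + y ^ 2 := by positivity
  have hrew : 2 * (1 - y * (y / (x ^ 2 + y ^ 2))) = 2 * x ^ 2 / (x ^ 2 + y ^ 2) := by
    field_simp
    ring
  simp only [hrew]
  refine Set.indicator_apply_le' (fun hx => ?_) (fun _ => by positivity)
  have hx' : y < |x| := by simpa using hx
  have hsq : y ^ 2 < x ^ 2 := sq_lt_sq.2 (by rwa [abs_of_pos hy])
  rw [Pi.one_apply, le_div_iff₀ hpos]
  linarith

lemma exists_isProbabilityMeasure_integral_inv_sub_eq (μ : Measure ℝ) [IsFiniteMeasure μ] :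
    ∃ ν : Measure ℝ, IsProbabilityMeasure ν ∧ ∀ z : ℂ, 0 < z.im →
      ∫ t : ℝ, ((t : ℂ) - z)⁻¹ ∂ν = -1 / (z + ∫ x : ℝ, ((x : ℂ) - z)⁻¹ ∂μ) := by
  let g : ℕ → SimpleFunc ℝ ℝ := SimpleFunc.approxOn id measurable_id Set.univ 0 (Set.mem_univ 0)
  choose ν hν H using fun n => exists_isProbabilityMeasure_integral_inv_sub_eq_of_simpleFunc μ (g n)
  have htend {z : ℂ} (hz : 0 < z.im) : Tendsto (fun n => ∫ x : ℝ, ((x : ℂ) - z)⁻¹ ∂(μ.map (g n)))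
      atTop (𝓝 (∫ x : ℝ, ((x : ℂ) - z)⁻¹ ∂μ)) := by
    have hmap (n : ℕ) := integral_map (μ := μ) (g n).measurable.aemeasurable
      (continuous_inv_ofReal_sub hz).aestronglyMeasurable
    simp_rw [hmap]
    refine tendsto_integral_of_dominated_convergence (fun _ => z.im⁻¹)
      (fun n => ((continuous_inv_ofReal_sub hz).measurable.comp
        (g n).measurable).aestronglyMeasurable) (integrable_const _)
      (fun n => .of_forall fun x => norm_inv_ofReal_sub_le hz _) (.of_forall fun x => ?_)
    exact ((continuous_inv_ofReal_sub hz).tendsto x).comp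
      (SimpleFunc.tendsto_approxOn measurable_id (Set.mem_univ 0) (by simp))
  let P : ℕ → ProbabilityMeasure ℝ := fun n => ⟨ν n, hν n⟩
  let u : ℕ → NNReal := fun n => 2 * (μ.real Set.univ / ((n : ℝ) + 1) ^ 2).toNNReal
  have hu : Tendsto u atTop (𝓝 0) := by
    have h1 : Tendsto (fun n : ℕ => ((n : ℝ) + 1) ^ 2) atTop atTop :=
      (tendsto_pow_atTop two_ne_zero).comp (tendsto_atTop_add_const_right _ _
        tendsto_natCast_atTop_atTop)
    have h2 := (continuous_real_toNNReal.tendsto 0).comp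
      ((tendsto_const_nhds (x := μ.real Set.univ)).div_atTop h1)
    simpa [u, Function.comp_def] using h2.const_mul 2
  have hK := isCompact_setOfPred_probabilityMeasure_mass_eq_compl_isCompact_le (E := ℝ) hu
    (fun n => isCompact_closedBall 0 ((n : ℝ) + 1)) (.inl inferInstance)
  obtain ⟨Q, -, hQ⟩ := hK.ultrafilter_le_nhds ((hyperfilter ℕ).map P) (by
    rw [le_principal_iff]
    refine Filter.mem_map.2 (Filter.Eventually.of_forall fun n k => ?_)
    have hb := measureReal_compl_closedBall_le (H n) (y := (k : ℝ) + 1) (by positivity)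
    rw [map_measureReal_apply (g n).measurable .univ, Set.preimage_univ] at hb
    rw [← NNReal.coe_le_coe]
    refine hb.trans_eq ?_
    simp [u, Real.coe_toNNReal _ (div_nonneg measureReal_nonneg (sq_nonneg _))])
  refine ⟨Q, inferInstance, fun z hz => ?_⟩
  have hQ' : Tendsto P (hyperfilter ℕ) (𝓝 Q) := hQ
  have h1 := (ProbabilityMeasure.tendsto_iff_forall_integral_rclike_tendsto ℂ).1 hQ'
    (BoundedContinuousFunction.ofNormedAddCommGroup _ (continuous_inv_ofReal_sub hz) _
      (norm_inv_ofReal_sub_le hz))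
  refine tendsto_nhds_unique h1 ?_
  have h2 : Tendsto (fun n => -1 / (z + ∫ x : ℝ, ((x : ℂ) - z)⁻¹ ∂(μ.map (g n)))) atTop
      (𝓝 (-1 / (z + ∫ x : ℝ, ((x : ℂ) - z)⁻¹ ∂μ))) :=
    tendsto_const_nhds.div (tendsto_const_nhds.add (htend hz))
      (add_integral_inv_ofReal_sub_ne_zero μ hz)
  refine (h2.mono_left Nat.hyperfilter_le_atTop).congr fun n => ?_
  exact (H n z hz).symm

/-- Let `μ` be a finite Borel measure on `ℝ` with Stieltjes transform
`s_μ(z) = ∫ (ξ - z)⁻¹ dμ(ξ)`. Then `Im (z + s_μ(z)) > 0` for every `z` in the upper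
half-plane, and there is a unique Borel probability measure `ν` on `ℝ` whose Stieltjes
transform satisfies `s_ν(z) = -1/(z + s_μ(z))` on the upper half-plane. -/
theorem stmt_10 (μ : Measure ℝ) [IsFiniteMeasure μ] :
    (∀ z : ℂ, 0 < z.im → 0 < (z + ∫ ξ : ℝ, ((ξ : ℂ) - z)⁻¹ ∂μ).im) ∧
    (∃! ν : Measure ℝ, IsProbabilityMeasure ν ∧
      ∀ z : ℂ, 0 < z.im →
        (∫ ξ : ℝ, ((ξ : ℂ) - z)⁻¹ ∂ν) = -1 / (z + ∫ ξ : ℝ, ((ξ : ℂ) - z)⁻¹ ∂μ)) := by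
  refine ⟨fun z hz => im_add_integral_inv_ofReal_sub_pos μ hz, ?_⟩
  obtain ⟨ν, hν, H⟩ := exists_isProbabilityMeasure_integral_inv_sub_eq μ
  refine ⟨ν, ⟨hν, H⟩, ?_⟩
  rintro ν' ⟨hν', H'⟩
  exact ext_of_integral_inv_ofReal_sub_eq fun z hz => (H' z hz).trans (H z hz).symm
end

section
/- Let μ be a finite Borel measure on ℝ with Stieltjes transform s_μ, and let λ ∈ ℝ. Then ε·s_μ(λ + iε) converges to i·μ({λ}) as ε → 0⁺. -/
open MeasureTheory

/-- Let `μ` be a finite Borel measure on `ℝ` with Stieltjes transform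
`s_μ(z) = ∫ (ξ - z)⁻¹ dμ(ξ)`, and `λ ∈ ℝ`. Then `ε · s_μ(λ + iε) → i·μ({λ})` as `ε → 0⁺`. -/
theorem stmt_11 (μ : Measure ℝ) [IsFiniteMeasure μ] (lam : ℝ) :
    Filter.Tendsto
      (fun ε : ℝ => (ε : ℂ) *
        ∫ ξ : ℝ, ((ξ : ℂ) - ((lam : ℂ) + ε * Complex.I))⁻¹ ∂μ)
      (nhdsWithin 0 (Set.Ioi 0))
      (nhds (Complex.I * ((μ {lam}).toReal : ℂ))) := by
  have integral_limit : ∫ ξ : ℝ, ({lam} : Set ℝ).indicator (fun _ => Complex.I) ξ ∂μ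
      = Complex.I * ((μ {lam}).toReal : ℂ) := by
    rw [integral_indicator_const _ (measurableSet_singleton lam), Complex.real_smul, mul_comm]
    rfl
  simp_rw [← integral_limit, ← integral_const_mul]
  refine tendsto_integral_filter_of_dominated_convergence (fun _ => 1) ?_ ?_
    (integrable_const 1) ?_
  · exact Filter.Eventually.of_forall fun ε => by
      apply Measurable.aestronglyMeasurable
      fun_prop
  · filter_upwards [self_mem_nhdsWithin] with ε (hε : 0 < ε)
    refine Filter.Eventually.of_forall fun ξ => ?_
    have le_norm : ε ≤ ‖(ξ : ℂ) - ((lam : ℂ) + ε * Complex.I)‖ := by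
      simpa [abs_of_pos hε] using
        Complex.abs_im_le_norm ((ξ : ℂ) - ((lam : ℂ) + ε * Complex.I))
    rw [norm_mul, norm_inv, Complex.norm_real, Real.norm_of_nonneg hε.le, ← div_eq_mul_inv]
    exact div_le_one_of_le₀ le_norm (norm_nonneg _)
  · refine Filter.Eventually.of_forall fun ξ => ?_
    by_cases h : ξ = lam
    · subst h
      refine tendsto_const_nhds.congr' ?_
      filter_upwards [self_mem_nhdsWithin] with ε (hε : 0 < ε)
      have ne_zero : (ε : ℂ) ≠ 0 := Complex.ofReal_ne_zero.mpr hε.ne'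
      simp [mul_comm]
      field_simp
    · have sub_ne_zero' : (ξ : ℂ) - ((lam : ℂ) + (0 : ℝ) * Complex.I) ≠ 0 := by
        simpa [sub_eq_zero] using h
      have continuousAt_zero : ContinuousAt
          (fun ε : ℝ => (ε : ℂ) * ((ξ : ℂ) - ((lam : ℂ) + ε * Complex.I))⁻¹) 0 :=
        Complex.continuous_ofReal.continuousAt.mul
          (ContinuousAt.inv₀ (by fun_prop) sub_ne_zero')
      simpa [h] using continuousAt_zero.tendsto.mono_left nhdsWithin_le_nhds
end

section
/- Let μ be a finite Borel measure on ℝ, let λ ∈ ℝ, and suppose β := ∫_ℝ (ξ − λ)^{−2} dμ(ξ) < ∞. Then the function ξ ↦ (ξ − λ)^{−1} is μ-integrable; writing γ := ∫_ℝ (ξ − λ)^{−1} dμ(ξ) and s_μ for the Stieltjes transform of μ, one has (s_μ(λ + iε) − γ − iβε)/ε → 0 as ε → 0⁺. -/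
open MeasureTheory

/-- The Stieltjes kernel at height `ε > 0` is bounded by `ε⁻¹`. -/
lemma norm_inv_ofReal_sub_le_s13 (ξ lam : ℝ) {ε : ℝ} (hε : 0 < ε) :
    ‖((ξ : ℂ) - ((lam : ℂ) + ε * Complex.I))⁻¹‖ ≤ ε⁻¹ := by
  rw [norm_inv]
  refine inv_anti₀ hε ?_
  have h := Complex.abs_im_le_norm ((ξ : ℂ) - ((lam : ℂ) + ε * Complex.I))
  simpa [abs_of_pos hε] using h

/-- The Stieltjes kernel at height `ε > 0` is integrable for every finite measure. -/
lemma integrable_inv_ofReal_sub_s13 (μ : Measure ℝ) [IsFiniteMeasure μ] (lam : ℝ) {ε : ℝ}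
    (hε : 0 < ε) :
    Integrable (fun ξ : ℝ => ((ξ : ℂ) - ((lam : ℂ) + ε * Complex.I))⁻¹) μ :=
  Integrable.of_bound (by fun_prop) ε⁻¹
    (Filter.Eventually.of_forall fun ξ => norm_inv_ofReal_sub_le_s13 ξ lam hε)

/-- Second-order remainder of the Stieltjes kernel, divided by `ε`. -/
lemma inv_ofReal_sub_remainder {ξ lam ε : ℝ} (hξ : ξ ≠ lam) (hε : 0 < ε) :
    (((ξ : ℂ) - ((lam : ℂ) + ε * Complex.I))⁻¹ - (((ξ - lam)⁻¹ : ℝ) : ℂ)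
        - Complex.I * ((((ξ - lam) ^ 2)⁻¹ : ℝ) : ℂ) * (ε : ℂ)) / (ε : ℂ)
      = -(ε : ℂ) * ((((ξ - lam) ^ 2)⁻¹ : ℝ) : ℂ)
          * ((ξ : ℂ) - ((lam : ℂ) + ε * Complex.I))⁻¹ := by
  have hx : (ξ : ℂ) - lam ≠ 0 := sub_ne_zero.2 (by exact_mod_cast hξ)
  have hε' : (ε : ℂ) ≠ 0 := by exact_mod_cast hε.ne'
  have hz : (ξ : ℂ) - ((lam : ℂ) + ε * Complex.I) ≠ 0 := fun h => by
    have := congrArg Complex.im h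
    simp [hε.ne'] at this
  have key : (ξ : ℂ) - ((lam : ℂ) + ε * Complex.I) = ((ξ : ℂ) - lam) - ε * Complex.I := by ring
  rw [key] at hz ⊢
  push_cast
  generalize (ξ : ℂ) - lam = x at hx hz ⊢
  field_simp
  linear_combination ((ε : ℂ) ^ 2) * Complex.I_sq

/-- If `∫ (ξ - λ)⁻² dμ < ∞`, with integrand `∞` at `λ`, then `λ` is not an atom of `μ`. -/
lemma ae_ne_of_lintegral_inv_sq_ne_top {μ : Measure ℝ} {lam : ℝ}
    (hβ : (∫⁻ ξ : ℝ, (ENNReal.ofReal ((ξ - lam) ^ 2))⁻¹ ∂μ) ≠ ⊤) : ∀ᵐ ξ ∂μ, ξ ≠ lam := by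
  filter_upwards [ae_lt_top (by fun_prop) hβ] with ξ hξ h
  simp [h] at hξ

lemma lintegral_inv_sq_eq {μ : Measure ℝ} {lam : ℝ} (hne : ∀ᵐ ξ ∂μ, ξ ≠ lam) :
    ∫⁻ ξ : ℝ, (ENNReal.ofReal ((ξ - lam) ^ 2))⁻¹ ∂μ
      = ∫⁻ ξ : ℝ, ENNReal.ofReal ((ξ - lam) ^ 2)⁻¹ ∂μ := by
  refine lintegral_congr_ae ?_
  filter_upwards [hne] with ξ hξ
  have hpos : 0 < (ξ - lam) ^ 2 := by
    have := sub_ne_zero.2 hξ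
    positivity
  exact (ENNReal.ofReal_inv_of_pos hpos).symm

lemma integrable_inv_sq {μ : Measure ℝ} {lam : ℝ}
    (hβ : (∫⁻ ξ : ℝ, (ENNReal.ofReal ((ξ - lam) ^ 2))⁻¹ ∂μ) ≠ ⊤) :
    Integrable (fun ξ : ℝ => ((ξ - lam) ^ 2)⁻¹) μ := by
  have hm : Measurable fun ξ : ℝ => ((ξ - lam) ^ 2)⁻¹ := by fun_prop
  refine (lintegral_ofReal_ne_top_iff_integrable hm.aestronglyMeasurable
    (Filter.Eventually.of_forall fun ξ => by positivity)).1 ?_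
  rwa [← lintegral_inv_sq_eq (ae_ne_of_lintegral_inv_sq_ne_top hβ)]

lemma toReal_lintegral_inv_sq {μ : Measure ℝ} {lam : ℝ}
    (hβ : (∫⁻ ξ : ℝ, (ENNReal.ofReal ((ξ - lam) ^ 2))⁻¹ ∂μ) ≠ ⊤) :
    (∫⁻ ξ : ℝ, (ENNReal.ofReal ((ξ - lam) ^ 2))⁻¹ ∂μ).toReal
      = ∫ ξ : ℝ, ((ξ - lam) ^ 2)⁻¹ ∂μ := by
  rw [lintegral_inv_sq_eq (ae_ne_of_lintegral_inv_sq_ne_top hβ)]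
  exact (integral_eq_lintegral_of_nonneg_ae (Filter.Eventually.of_forall fun ξ => by positivity)
    (integrable_inv_sq hβ).aestronglyMeasurable).symm

lemma integrable_inv_sub {μ : Measure ℝ} [IsFiniteMeasure μ] {lam : ℝ}
    (hsq : Integrable (fun ξ : ℝ => ((ξ - lam) ^ 2)⁻¹) μ) :
    Integrable (fun ξ : ℝ => (ξ - lam)⁻¹) μ := by
  have hm : Measurable fun ξ : ℝ => (ξ - lam)⁻¹ := by fun_prop
  refine ((integrable_const (1 : ℝ)).add hsq).mono' hm.aestronglyMeasurable
    (Filter.Eventually.of_forall fun ξ => ?_)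
  simp only [Pi.add_apply, Real.norm_eq_abs, ← inv_pow]
  rw [← sq_abs]
  nlinarith [sq_nonneg (|(ξ - lam)⁻¹| - 1), sq_nonneg (|(ξ - lam)⁻¹|)]

/-- The scaled remainder, integrated against `μ`, vanishes as `ε → 0⁺`. -/
lemma tendsto_integral_remainder {μ : Measure ℝ} {lam : ℝ} (hne : ∀ᵐ ξ ∂μ, ξ ≠ lam)
    (hsq : Integrable (fun ξ : ℝ => ((ξ - lam) ^ 2)⁻¹) μ) :
    Filter.Tendsto
      (fun ε : ℝ => ∫ ξ : ℝ, -(ε : ℂ) * ((((ξ - lam) ^ 2)⁻¹ : ℝ) : ℂ)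
        * ((ξ : ℂ) - ((lam : ℂ) + ε * Complex.I))⁻¹ ∂μ)
      (nhdsWithin 0 (Set.Ioi 0)) (nhds 0) := by
  rw [← integral_zero ℝ ℂ (μ := μ)]
  refine tendsto_integral_filter_of_dominated_convergence (fun ξ => ((ξ - lam) ^ 2)⁻¹)
    (Filter.Eventually.of_forall fun ε => by fun_prop) ?_ hsq ?_
  · filter_upwards [self_mem_nhdsWithin] with ε hε
    have hε : 0 < ε := hε
    refine Filter.Eventually.of_forall fun ξ => ?_
    have hsq_nonneg : 0 ≤ ((ξ - lam) ^ 2)⁻¹ := by positivity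
    rw [norm_mul, norm_mul, norm_neg, Complex.norm_real, Complex.norm_real,
      Real.norm_of_nonneg hε.le, Real.norm_of_nonneg hsq_nonneg]
    calc ε * ((ξ - lam) ^ 2)⁻¹ * ‖((ξ : ℂ) - ((lam : ℂ) + ε * Complex.I))⁻¹‖
        ≤ ε * ((ξ - lam) ^ 2)⁻¹ * ε⁻¹ := by
          gcongr
          exact norm_inv_ofReal_sub_le_s13 ξ lam hε
      _ = ((ξ - lam) ^ 2)⁻¹ := by field_simp
  · filter_upwards [hne] with ξ hξ
    have hx : (ξ : ℂ) - ((lam : ℂ) + ((0 : ℝ) : ℂ) * Complex.I) ≠ 0 := by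
      simpa [sub_eq_zero] using hξ
    have hcont : ContinuousAt (fun ε : ℝ => -(ε : ℂ) * ((((ξ - lam) ^ 2)⁻¹ : ℝ) : ℂ)
        * ((ξ : ℂ) - ((lam : ℂ) + ε * Complex.I))⁻¹) 0 :=
      ContinuousAt.mul (by fun_prop) (ContinuousAt.inv₀ (by fun_prop) hx)
    simpa using hcont.tendsto.mono_left nhdsWithin_le_nhds

/-- Let `μ` be a finite Borel measure on `ℝ` with Stieltjes transform
`s_μ`, `λ ∈ ℝ`, and suppose `β := ∫ (ξ - λ)⁻² dμ(ξ) < ∞` (the integrand being `∞` at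
`ξ = λ`). Then `ξ ↦ (ξ - λ)⁻¹` is `μ`-integrable and, with `γ := ∫ (ξ - λ)⁻¹ dμ(ξ)`,
`(s_μ(λ + iε) - γ - iβε)/ε → 0` as `ε → 0⁺`. -/
theorem stmt_13 (μ : Measure ℝ) [IsFiniteMeasure μ] (lam : ℝ)
    (hβ : (∫⁻ ξ : ℝ, (ENNReal.ofReal ((ξ - lam) ^ 2))⁻¹ ∂μ) ≠ ⊤) :
    Integrable (fun ξ : ℝ => (ξ - lam)⁻¹) μ ∧
    Filter.Tendsto
      (fun ε : ℝ =>
        ((∫ ξ : ℝ, ((ξ : ℂ) - ((lam : ℂ) + ε * Complex.I))⁻¹ ∂μ)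
            - ((∫ ξ : ℝ, (ξ - lam)⁻¹ ∂μ : ℝ) : ℂ)
            - Complex.I * ((∫⁻ ξ : ℝ, (ENNReal.ofReal ((ξ - lam) ^ 2))⁻¹ ∂μ).toReal : ℂ)
                * (ε : ℂ)) / (ε : ℂ))
      (nhdsWithin 0 (Set.Ioi 0)) (nhds 0) := by
  have hne := ae_ne_of_lintegral_inv_sq_ne_top hβ
  have hsq := integrable_inv_sq hβ
  have hinv := integrable_inv_sub hsq
  refine ⟨hinv, (tendsto_integral_remainder hne hsq).congr' ?_⟩
  filter_upwards [self_mem_nhdsWithin] with ε hε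
  have hε : 0 < ε := hε
  have hker := integrable_inv_ofReal_sub_s13 μ lam hε
  have hinvC : Integrable (fun ξ : ℝ => (((ξ - lam)⁻¹ : ℝ) : ℂ)) μ := hinv.ofReal
  have hdiff : Integrable (fun ξ : ℝ => ((ξ : ℂ) - ((lam : ℂ) + ε * Complex.I))⁻¹
      - (((ξ - lam)⁻¹ : ℝ) : ℂ)) μ := hker.sub hinvC
  have hsqC : Integrable (fun ξ : ℝ => Complex.I * ((((ξ - lam) ^ 2)⁻¹ : ℝ) : ℂ) * (ε : ℂ)) μ :=
    (hsq.ofReal.const_mul _).mul_const _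
  rw [toReal_lintegral_inv_sq hβ, ← integral_complex_ofReal, ← integral_complex_ofReal,
    ← integral_const_mul, ← integral_mul_const, ← integral_sub hker hinvC,
    ← integral_sub hdiff hsqC, ← integral_div]
  refine integral_congr_ae ?_
  filter_upwards [hne] with ξ hξ
  exact (inv_ofReal_sub_remainder hξ hε).symm
end

section
/- Let μ be a finite Borel measure on ℝ with Stieltjes transform s_μ, let λ ∈ ℝ, and let ν be a Borel probability measure on ℝ whose Stieltjes transform satisfies s_ν(z) = −1/(z + s_μ(z)) for all z in the upper half-plane. If α := μ({λ}) > 0, then ν({λ}) = 0, ∫_ℝ (ξ − λ)^{−2} dν(ξ) = 1/α, and ∫_ℝ (ξ − λ)^{−1} dν(ξ) = 0. -/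
open MeasureTheory

open Filter Topology Complex

/-- The denominator `ξ - (x + iη)` of the Stieltjes kernel has norm at least `η`. -/
lemma le_norm_ofReal_sub_add_mul_I (ξ x η : ℝ) : η ≤ ‖(ξ : ℂ) - (x + η * I)‖ := by
  have h := abs_im_le_norm ((ξ : ℂ) - (x + η * I))
  simp only [sub_im, ofReal_im, add_im, mul_im, ofReal_re, I_im, I_re] at h
  exact (le_abs_self η).trans (by simpa using h)

lemma abs_sub_le_norm_ofReal_sub_add_mul_I (ξ x η : ℝ) :
    |ξ - x| ≤ ‖(ξ : ℂ) - (x + η * I)‖ := by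
  have h := abs_re_le_norm ((ξ : ℂ) - (x + η * I))
  simpa using h

lemma measurable_stieltjes_kernel (z : ℂ) : Measurable fun ξ : ℝ => ((ξ : ℂ) - z)⁻¹ := by
  fun_prop

lemma integrable_stieltjes_kernel (μ : Measure ℝ) [IsFiniteMeasure μ] (x : ℝ) {η : ℝ}
    (hη : 0 < η) : Integrable (fun ξ : ℝ => ((ξ : ℂ) - (x + η * I))⁻¹) μ := by
  refine Integrable.of_bound (measurable_stieltjes_kernel _).aestronglyMeasurable η⁻¹
    (ae_of_all _ fun ξ => ?_)
  rw [norm_inv]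
  exact inv_anti₀ hη (le_norm_ofReal_sub_add_mul_I ξ x η)

lemma im_stieltjes_kernel (ξ x η : ℝ) :
    (((ξ : ℂ) - (x + η * I))⁻¹).im = η * ((ξ - x) ^ 2 + η ^ 2)⁻¹ := by
  rw [inv_im, normSq_apply]
  simp [div_eq_mul_inv, pow_two]

/-- The atom of `μ` at `x` is recovered from the vertical limit of its Stieltjes transform. -/
lemma tendsto_mul_stieltjes_atom (μ : Measure ℝ) [IsFiniteMeasure μ] (x : ℝ) :
    Tendsto (fun η : ℝ => (η : ℂ) * ∫ ξ : ℝ, ((ξ : ℂ) - (x + η * I))⁻¹ ∂μ) (𝓝[>] 0)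
      (𝓝 (μ.real {x} * I)) := by
  have hlim : ∫ ξ : ℝ, ({x} : Set ℝ).indicator (fun _ => I) ξ ∂μ = μ.real {x} * I := by
    rw [integral_indicator (measurableSet_singleton x)]
    simp [Measure.real]
  simp_rw [← integral_const_mul]
  rw [← hlim]
  refine tendsto_integral_filter_of_dominated_convergence (fun _ => 1) ?_ ?_
    (integrable_const _) ?_
  · exact Eventually.of_forall fun η =>
      ((measurable_stieltjes_kernel _).const_mul _).aestronglyMeasurable
  · filter_upwards [self_mem_nhdsWithin] with η (hη : 0 < η)
    refine ae_of_all _ fun ξ => ?_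
    have h := le_norm_ofReal_sub_add_mul_I ξ x η
    rw [norm_mul, norm_inv, ← div_eq_mul_inv, norm_real, Real.norm_of_nonneg hη.le]
    exact div_le_one_of_le₀ h (norm_nonneg _)
  · refine ae_of_all _ fun ξ => ?_
    by_cases hξ : ξ = x
    · subst hξ
      rw [Set.indicator_of_mem (Set.mem_singleton ξ)]
      refine tendsto_const_nhds.congr' ?_
      filter_upwards [self_mem_nhdsWithin] with η (hη : 0 < η)
      have : (η : ℂ) ≠ 0 := ofReal_ne_zero.2 hη.ne'
      rw [sub_add_cancel_left, inv_neg, mul_inv, inv_I]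
      field_simp
    · rw [Set.indicator_of_notMem (by simpa using hξ)]
      refine Tendsto.mono_left ?_ nhdsWithin_le_nhds
      have hne : (ξ : ℂ) - (x + (0 : ℝ) * I) ≠ 0 := by
        simpa [sub_eq_zero] using hξ
      have hc : ContinuousAt (fun η : ℝ => (η : ℂ) * ((ξ : ℂ) - (x + η * I))⁻¹) 0 :=
        continuous_ofReal.continuousAt.mul
          (ContinuousAt.inv₀ (by fun_prop) hne)
      simpa [ContinuousAt] using hc

/-- Vertical boundary value of the Stieltjes transform where the boundary kernel is integrable. -/
lemma tendsto_stieltjes_of_integrable_inv (ν : Measure ℝ) (x : ℝ) (hx : ν {x} = 0)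
    (hint : Integrable (fun ξ : ℝ => (ξ - x)⁻¹) ν) :
    Tendsto (fun η : ℝ => ∫ ξ : ℝ, ((ξ : ℂ) - (x + η * I))⁻¹ ∂ν) (𝓝[>] 0)
      (𝓝 ((∫ ξ : ℝ, (ξ - x)⁻¹ ∂ν : ℝ) : ℂ)) := by
  have hae : ∀ᵐ ξ ∂ν, ξ ≠ x := by
    rw [ae_iff]
    simpa using hx
  rw [← integral_complex_ofReal]
  refine tendsto_integral_filter_of_dominated_convergence (fun ξ => ‖(ξ - x)⁻¹‖) ?_ ?_
    hint.norm ?_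
  · exact Eventually.of_forall fun η => (measurable_stieltjes_kernel _).aestronglyMeasurable
  · refine Eventually.of_forall fun η => ?_
    filter_upwards [hae] with ξ hξ
    rw [norm_inv, norm_inv]
    exact inv_anti₀ (by simpa [sub_eq_zero] using hξ)
      (abs_sub_le_norm_ofReal_sub_add_mul_I ξ x η)
  · filter_upwards [hae] with ξ hξ
    refine Tendsto.mono_left ?_ nhdsWithin_le_nhds
    have hne : (ξ : ℂ) - (x + (0 : ℝ) * I) ≠ 0 := by
      simpa [sub_eq_zero] using hξ
    have hc : ContinuousAt (fun η : ℝ => ((ξ : ℂ) - (x + η * I))⁻¹) 0 :=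
      ContinuousAt.inv₀ (by fun_prop) hne
    simpa [ContinuousAt] using hc

/-- `∫⁻ (ξ - x)⁻²` is the limit of the rescaled imaginary part of the Stieltjes transform. -/
lemma tendsto_ofReal_im_stieltjes (ν : Measure ℝ) [IsFiniteMeasure ν] (x : ℝ)
    {η : ℕ → ℝ} (hη : Antitone η) (hpos : ∀ n, 0 < η n) (h0 : Tendsto η atTop (𝓝 0)) :
    Tendsto (fun n => ENNReal.ofReal
        ((η n)⁻¹ * (∫ ξ : ℝ, ((ξ : ℂ) - (x + η n * I))⁻¹ ∂ν).im)) atTop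
      (𝓝 (∫⁻ ξ : ℝ, (ENNReal.ofReal ((ξ - x) ^ 2))⁻¹ ∂ν)) := by
  have heq (n : ℕ) : ENNReal.ofReal
      ((η n)⁻¹ * (∫ ξ : ℝ, ((ξ : ℂ) - (x + η n * I))⁻¹ ∂ν).im) =
      ∫⁻ ξ : ℝ, (ENNReal.ofReal ((ξ - x) ^ 2 + η n ^ 2))⁻¹ ∂ν := by
    have hi := integrable_stieltjes_kernel ν x (hpos n)
    have him : (∫ ξ : ℝ, ((ξ : ℂ) - (x + η n * I))⁻¹ ∂ν).im =
        ∫ ξ : ℝ, (((ξ : ℂ) - (x + η n * I))⁻¹).im ∂ν := (integral_im hi).symm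
    have hi' : Integrable (fun ξ : ℝ => (η n)⁻¹ * (((ξ : ℂ) - (x + η n * I))⁻¹).im) ν :=
      hi.im.const_mul _
    have hk (ξ : ℝ) : (η n)⁻¹ * (((ξ : ℂ) - (x + η n * I))⁻¹).im =
        ((ξ - x) ^ 2 + η n ^ 2)⁻¹ := by
      rw [im_stieltjes_kernel, inv_mul_cancel_left₀ (hpos n).ne']
    simp_rw [hk] at hi'
    rw [him, ← integral_const_mul]
    simp_rw [hk]
    rw [ofReal_integral_eq_lintegral_ofReal hi' (ae_of_all _ fun ξ => by positivity)]
    refine lintegral_congr fun ξ => ENNReal.ofReal_inv_of_pos ?_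
    have := hpos n
    positivity
  simp_rw [heq]
  refine lintegral_tendsto_of_tendsto_of_monotone (fun n => by fun_prop)
    (ae_of_all _ fun ξ m n hmn => ?_) (ae_of_all _ fun ξ => ?_)
  · refine ENNReal.inv_le_inv.2 (ENNReal.ofReal_le_ofReal ?_)
    have := pow_le_pow_left₀ (hpos n).le (hη hmn) 2
    linarith
  · refine tendsto_inv_iff.2 (ENNReal.tendsto_ofReal ?_)
    simpa using (h0.pow 2).const_add ((ξ - x) ^ 2)

lemma measure_singleton_eq_zero_of_lintegral_inv_sq_ne_top (ν : Measure ℝ) (x : ℝ)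
    (h : ∫⁻ ξ : ℝ, (ENNReal.ofReal ((ξ - x) ^ 2))⁻¹ ∂ν ≠ ⊤) : ν {x} = 0 := by
  have hae := ae_lt_top (by fun_prop) h
  rw [ae_iff] at hae
  refine measure_mono_null ?_ hae
  rintro ξ rfl
  simp

lemma integrable_inv_sub_of_lintegral_inv_sq_ne_top (ν : Measure ℝ) [IsFiniteMeasure ν] (x : ℝ)
    (h : ∫⁻ ξ : ℝ, (ENNReal.ofReal ((ξ - x) ^ 2))⁻¹ ∂ν ≠ ⊤) :
    Integrable (fun ξ : ℝ => (ξ - x)⁻¹) ν := by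
  have hm : AEStronglyMeasurable (fun ξ : ℝ => (ξ - x)⁻¹) ν :=
    Measurable.aestronglyMeasurable (by fun_prop)
  have hsq : Integrable (fun ξ : ℝ => (ξ - x)⁻¹ ^ 2) ν := by
    refine ⟨hm.pow 2, ?_⟩
    rw [hasFiniteIntegral_iff_ofReal (ae_of_all _ fun ξ => by positivity)]
    refine lt_of_le_of_lt (lintegral_mono fun ξ => ?_) h.lt_top
    by_cases hξ : ξ = x
    · simp [hξ]
    · have : 0 < (ξ - x) ^ 2 := by
        have := sub_ne_zero.2 hξ
        positivity
      rw [inv_pow, ENNReal.ofReal_inv_of_pos this]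
  exact ((memLp_two_iff_integrable_sq hm).2 hsq).integrable (by norm_num)

/-- Let `μ` be a finite Borel measure on `ℝ` with Stieltjes transform
`s_μ`, `λ ∈ ℝ`, and let `ν` be a Borel probability measure with `s_ν(z) = -1/(z + s_μ(z))`
on the upper half-plane. If `α := μ({λ}) > 0` then `ν({λ}) = 0`,
`∫ (ξ - λ)⁻² dν(ξ) = 1/α` (in `[0, ∞]`, the integrand being `∞` at `ξ = λ`), and
`∫ (ξ - λ)⁻¹ dν(ξ) = 0` (with `ξ ↦ (ξ - λ)⁻¹` being `ν`-integrable). -/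
theorem stmt_14 (μ : Measure ℝ) [IsFiniteMeasure μ] (lam : ℝ)
    (ν : Measure ℝ) [IsProbabilityMeasure ν]
    (hν : ∀ z : ℂ, 0 < z.im →
      (∫ ξ : ℝ, ((ξ : ℂ) - z)⁻¹ ∂ν) = -1 / (z + ∫ ξ : ℝ, ((ξ : ℂ) - z)⁻¹ ∂μ))
    (hα : 0 < μ {lam}) :
    ν {lam} = 0 ∧
    (∫⁻ ξ : ℝ, (ENNReal.ofReal ((ξ - lam) ^ 2))⁻¹ ∂ν) = (μ {lam})⁻¹ ∧
    Integrable (fun ξ : ℝ => (ξ - lam)⁻¹) ν ∧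
    (∫ ξ : ℝ, (ξ - lam)⁻¹ ∂ν) = 0 := by
  have hαr : 0 < μ.real {lam} := ENNReal.toReal_pos hα.ne' (measure_ne_top _ _)
  have hαc : (μ.real {lam} : ℂ) ≠ 0 := ofReal_ne_zero.2 hαr.ne'
  have hscaled : Tendsto
      (fun η : ℝ => (η : ℂ)⁻¹ * ∫ ξ : ℝ, ((ξ : ℂ) - (lam + η * I))⁻¹ ∂ν) (𝓝[>] 0)
      (𝓝 (((μ.real {lam})⁻¹ : ℝ) * I)) := by
    have hz : Tendsto (fun η : ℝ => (η : ℂ) * (lam + η * I)) (𝓝[>] 0) (𝓝 0) := by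
      refine Tendsto.mono_left ?_ nhdsWithin_le_nhds
      have hc : Continuous fun η : ℝ => (η : ℂ) * (lam + η * I) := by fun_prop
      simpa using hc.tendsto 0
    have hden := hz.add (tendsto_mul_stieltjes_atom μ lam)
    rw [zero_add] at hden
    have hinv := (hden.inv₀ (mul_ne_zero hαc I_ne_zero)).neg
    have hval : -((μ.real {lam} : ℂ) * I)⁻¹ = ((μ.real {lam})⁻¹ : ℝ) * I := by
      rw [mul_inv, inv_I, ofReal_inv]
      ring
    rw [hval] at hinv
    refine hinv.congr' ?_
    filter_upwards [self_mem_nhdsWithin] with η (hη : 0 < η)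
    rw [hν _ (by simpa using hη), ← mul_add, mul_inv, neg_div, one_div, mul_neg]
  have hlint : ∫⁻ ξ : ℝ, (ENNReal.ofReal ((ξ - lam) ^ 2))⁻¹ ∂ν = (μ {lam})⁻¹ := by
    let η : ℕ → ℝ := fun n => 1 / ((n : ℝ) + 1)
    have hpos (n : ℕ) : 0 < η n := Nat.one_div_pos_of_nat
    have h0 : Tendsto η atTop (𝓝 0) := tendsto_one_div_add_atTop_nhds_zero_nat
    have h0' : Tendsto η atTop (𝓝[>] 0) :=
      tendsto_nhdsWithin_iff.2 ⟨h0, Eventually.of_forall hpos⟩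
    refine tendsto_nhds_unique (tendsto_ofReal_im_stieltjes ν lam
      (fun _ _ h => Nat.one_div_le_one_div h) hpos h0) ?_
    have hlim := ENNReal.tendsto_ofReal
      ((continuous_im.tendsto _).comp (hscaled.comp h0'))
    have hval : ENNReal.ofReal ((((μ.real {lam})⁻¹ : ℝ) : ℂ) * I).im = (μ {lam})⁻¹ := by
      rw [im_ofReal_mul, I_im, mul_one, ENNReal.ofReal_inv_of_pos hαr, ofReal_measureReal]
    rw [hval] at hlim
    refine hlim.congr fun n => ?_
    simp only [Function.comp_apply]
    rw [← ofReal_inv, im_ofReal_mul]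
  have hfin : ∫⁻ ξ : ℝ, (ENNReal.ofReal ((ξ - lam) ^ 2))⁻¹ ∂ν ≠ ⊤ := by
    rw [hlint]
    exact ENNReal.inv_ne_top.2 hα.ne'
  have hatom := measure_singleton_eq_zero_of_lintegral_inv_sq_ne_top ν lam hfin
  have hint := integrable_inv_sub_of_lintegral_inv_sq_ne_top ν lam hfin
  refine ⟨hatom, hlint, hint, ?_⟩
  have hη0 : Tendsto (fun η : ℝ => (η : ℂ)) (𝓝[>] 0) (𝓝 0) :=
    (continuous_ofReal.tendsto' 0 0 ofReal_zero).mono_left nhdsWithin_le_nhds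
  have hzero := hη0.mul hscaled
  rw [zero_mul] at hzero
  refine ofReal_eq_zero.1 (tendsto_nhds_unique
    (tendsto_stieltjes_of_integrable_inv ν lam hatom hint) (hzero.congr' ?_))
  filter_upwards [self_mem_nhdsWithin] with η (hη : 0 < η)
  exact mul_inv_cancel_left₀ (ofReal_ne_zero.2 hη.ne') _
end

section
/- Let μ be a finite Borel measure on ℝ with Stieltjes transform s_μ, let λ ∈ ℝ, and let ν be a Borel probability measure on ℝ whose Stieltjes transform satisfies s_ν(z) = −1/(z + s_μ(z)) for all z in the upper half-plane. If μ({λ}) = 0, β := ∫_ℝ (ξ − λ)^{−2} dμ(ξ) < ∞, and γ := ∫_ℝ (ξ − λ)^{−1} dμ(ξ) = −λ, then ν({λ}) = 1/(1 + β) and ∫_ℝ (ξ − λ)^{−2} dν(ξ) = ∞. -/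
open MeasureTheory

open Filter Topology Complex

lemma abs_le_norm_sub_add_mul_I (x a ε : ℝ) :
    |ε| ≤ ‖(x : ℂ) - (a + ε * I)‖ := by
  simpa using Complex.abs_im_le_norm ((x : ℂ) - (a + ε * I))

lemma abs_sub_le_norm_sub_add_mul_I (x a ε : ℝ) :
    |x - a| ≤ ‖(x : ℂ) - (a + ε * I)‖ := by
  simpa using Complex.abs_re_le_norm ((x : ℂ) - (a + ε * I))

lemma ofReal_sub_add_mul_I_ne_zero (x a : ℝ) {ε : ℝ} (hε : 0 < ε) :
    (x : ℂ) - (a + ε * I) ≠ 0 :=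
  norm_pos_iff.1 <| (abs_pos.2 hε.ne').trans_le (abs_le_norm_sub_add_mul_I x a ε)

lemma tendsto_ofReal_sub_add_mul_I (x a : ℝ) :
    Tendsto (fun ε : ℝ => (x : ℂ) - (a + ε * I)) (𝓝[>] 0) (𝓝 ((x - a : ℝ) : ℂ)) := by
  have h : Continuous fun ε : ℝ => (x : ℂ) - (a + ε * I) := by fun_prop
  simpa using (h.tendsto 0).mono_left nhdsWithin_le_nhds

/-- The mass of an atom is recovered from the Stieltjes transform along a vertical line. -/
lemma tendsto_neg_mul_stieltjes (ν : Measure ℝ) [IsFiniteMeasure ν] (a : ℝ) :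
    Tendsto (fun ε : ℝ => -(ε * I) * ∫ x : ℝ, ((x : ℂ) - (a + ε * I))⁻¹ ∂ν)
      (𝓝[>] 0) (𝓝 (ν.real {a} : ℂ)) := by
  have hlim : ∫ x : ℝ, ({a} : Set ℝ).indicator (fun _ => (1 : ℂ)) x ∂ν = (ν.real {a} : ℂ) := by
    rw [integral_indicator_const _ (measurableSet_singleton a)]
    simp
  rw [← hlim]
  simp_rw [← integral_const_mul]
  refine tendsto_integral_filter_of_dominated_convergence (fun _ => (1 : ℝ)) ?_ ?_
    (integrable_const _) ?_
  · exact Eventually.of_forall fun ε => by fun_prop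
  · filter_upwards with ε
    filter_upwards with x
    rw [norm_mul, norm_inv, ← div_eq_mul_inv]
    refine div_le_one_of_le₀ ?_ (norm_nonneg _)
    simpa using abs_le_norm_sub_add_mul_I x a ε
  · filter_upwards with x
    by_cases hx : x = a
    · subst hx
      refine tendsto_const_nhds.congr' ?_
      filter_upwards [self_mem_nhdsWithin] with ε hε
      have h : (ε : ℂ) ≠ 0 := by exact_mod_cast (ne_of_gt hε)
      simp [field]
    · have hne : ((x - a : ℝ) : ℂ) ≠ 0 := by exact_mod_cast sub_ne_zero.2 hx
      have h0 : Tendsto (fun ε : ℝ => -((ε : ℂ) * I)) (𝓝[>] 0) (𝓝 0) := by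
        have h : Continuous fun ε : ℝ => -((ε : ℂ) * I) := by fun_prop
        simpa using (h.tendsto 0).mono_left nhdsWithin_le_nhds
      simpa [hx] using h0.mul ((tendsto_ofReal_sub_add_mul_I x a).inv₀ hne)

/-- The difference quotient of the Stieltjes transform at a boundary point `a` converges along
the vertical line to the second inverse moment at `a`. -/
lemma tendsto_integral_inv_mul_inv (μ : Measure ℝ) (a : ℝ)
    (hint : Integrable (fun x : ℝ => ((x - a) ^ 2)⁻¹) μ) :
    Tendsto (fun ε : ℝ => ∫ x : ℝ, ((x : ℂ) - (a + ε * I))⁻¹ * ((x - a : ℝ) : ℂ)⁻¹ ∂μ)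
      (𝓝[>] 0) (𝓝 ((∫ x : ℝ, ((x - a) ^ 2)⁻¹ ∂μ : ℝ) : ℂ)) := by
  rw [← integral_complex_ofReal]
  refine tendsto_integral_filter_of_dominated_convergence _ ?_ ?_ hint ?_
  · exact Eventually.of_forall fun ε => by fun_prop
  · filter_upwards with ε
    filter_upwards with x
    by_cases hx : x - a = 0
    · simp [hx]
    · rw [norm_mul, norm_inv, norm_inv, Complex.norm_real, Real.norm_eq_abs, ← sq_abs, sq, mul_inv]
      have := abs_pos.2 hx
      gcongr
      exact abs_sub_le_norm_sub_add_mul_I x a ε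
  · filter_upwards with x
    by_cases hx : x - a = 0
    · simp [hx]
    · have hne : ((x - a : ℝ) : ℂ) ≠ 0 := by exact_mod_cast hx
      have := ((tendsto_ofReal_sub_add_mul_I x a).inv₀ hne).mul_const (((x - a : ℝ) : ℂ)⁻¹)
      convert this using 2
      push_cast
      rw [sq, mul_inv]

lemma integrable_inv_sub_of_sq (μ : Measure ℝ) [IsFiniteMeasure μ] (a : ℝ)
    (hint : Integrable (fun x : ℝ => ((x - a) ^ 2)⁻¹) μ) :
    Integrable (fun x : ℝ => (x - a)⁻¹) μ := by
  refine ((integrable_const (1 : ℝ)).add hint).mono' (by fun_prop) ?_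
  filter_upwards with x
  simp only [Pi.add_apply, Real.norm_eq_abs, ← inv_pow]
  rw [← sq_abs (x - a)⁻¹]
  nlinarith [sq_nonneg (|(x - a)⁻¹| - 1), sq_nonneg |(x - a)⁻¹|]

lemma integrable_stieltjes (μ : Measure ℝ) [IsFiniteMeasure μ] (a : ℝ) {ε : ℝ} (hε : 0 < ε) :
    Integrable (fun x : ℝ => ((x : ℂ) - (a + ε * I))⁻¹) μ := by
  refine (integrable_const ε⁻¹).mono' (by fun_prop) ?_
  filter_upwards with x
  rw [norm_inv]
  gcongr
  exact (le_abs_self ε).trans (abs_le_norm_sub_add_mul_I x a ε)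

lemma stieltjes_sub_integral_inv_sub (μ : Measure ℝ) [IsFiniteMeasure μ] (a : ℝ)
    (hα : μ {a} = 0) (hint : Integrable (fun x : ℝ => ((x - a) ^ 2)⁻¹) μ)
    {ε : ℝ} (hε : 0 < ε) :
    (∫ x : ℝ, ((x : ℂ) - (a + ε * I))⁻¹ ∂μ) - ((∫ x : ℝ, (x - a)⁻¹ ∂μ : ℝ) : ℂ) =
      ε * I * ∫ x : ℝ, ((x : ℂ) - (a + ε * I))⁻¹ * ((x - a : ℝ) : ℂ)⁻¹ ∂μ := by
  have hinv : Integrable (fun x : ℝ => (((x - a)⁻¹ : ℝ) : ℂ)) μ :=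
    (integrable_inv_sub_of_sq μ a hint).ofReal
  rw [← integral_complex_ofReal, ← integral_const_mul,
    ← integral_sub (integrable_stieltjes μ a hε) hinv]
  refine integral_congr_ae ?_
  filter_upwards [measure_eq_zero_iff_ae_notMem.1 hα] with x hx
  have hne : ((x - a : ℝ) : ℂ) ≠ 0 := by exact_mod_cast sub_ne_zero.2 hx
  have hz := ofReal_sub_add_mul_I_ne_zero x a hε
  simp only [ofReal_inv]
  rw [inv_sub_inv hz hne, div_eq_mul_inv, mul_inv, ← mul_assoc, ← mul_assoc]
  congr 2
  push_cast
  ring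

lemma lintegral_inv_sq_eq_top (ν : Measure ℝ) (a : ℝ) (h : ν {a} ≠ 0) :
    (∫⁻ x : ℝ, (ENNReal.ofReal ((x - a) ^ 2))⁻¹ ∂ν) = ⊤ := by
  by_contra hne
  refine h (measure_mono_null ?_ (measure_eq_top_of_lintegral_ne_top (by fun_prop) hne))
  rintro x rfl
  simp

/-- Let `μ` be a finite Borel measure on `ℝ` with Stieltjes transform
`s_μ`, `λ ∈ ℝ`, and let `ν` be a Borel probability measure with `s_ν(z) = -1/(z + s_μ(z))`
on the upper half-plane. If `μ({λ}) = 0`, `β := ∫ (ξ - λ)⁻² dμ(ξ) < ∞`, and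
`γ := ∫ (ξ - λ)⁻¹ dμ(ξ) = -λ`, then `ν({λ}) = 1/(1 + β)` and `∫ (ξ - λ)⁻² dν(ξ) = ∞`. -/
theorem stmt_15 (μ : Measure ℝ) [IsFiniteMeasure μ] (lam : ℝ)
    (ν : Measure ℝ) [IsProbabilityMeasure ν]
    (hν : ∀ z : ℂ, 0 < z.im →
      (∫ ξ : ℝ, ((ξ : ℂ) - z)⁻¹ ∂ν) = -1 / (z + ∫ ξ : ℝ, ((ξ : ℂ) - z)⁻¹ ∂μ))
    (hα : μ {lam} = 0)
    (hβ : (∫⁻ ξ : ℝ, (ENNReal.ofReal ((ξ - lam) ^ 2))⁻¹ ∂μ) ≠ ⊤)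
    (hγ : (∫ ξ : ℝ, (ξ - lam)⁻¹ ∂μ) = -lam) :
    ν {lam} = (1 + ∫⁻ ξ : ℝ, (ENNReal.ofReal ((ξ - lam) ^ 2))⁻¹ ∂μ)⁻¹ ∧
    (∫⁻ ξ : ℝ, (ENNReal.ofReal ((ξ - lam) ^ 2))⁻¹ ∂ν) = ⊤ := by
  have hae : (fun ξ : ℝ => (ENNReal.ofReal ((ξ - lam) ^ 2))⁻¹) =ᵐ[μ]
      fun ξ => ENNReal.ofReal (((ξ - lam) ^ 2)⁻¹) := by
    filter_upwards [measure_eq_zero_iff_ae_notMem.1 hα] with ξ hξ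
    have : 0 < (ξ - lam) ^ 2 := sq_pos_of_ne_zero (sub_ne_zero.2 hξ)
    exact (ENNReal.ofReal_inv_of_pos this).symm
  rw [lintegral_congr_ae hae] at hβ ⊢
  have hnonneg : 0 ≤ᵐ[μ] fun ξ : ℝ => ((ξ - lam) ^ 2)⁻¹ :=
    Eventually.of_forall fun ξ => by positivity
  have hint : Integrable (fun ξ : ℝ => ((ξ - lam) ^ 2)⁻¹) μ :=
    (lintegral_ofReal_ne_top_iff_integrable (by fun_prop) hnonneg).1 hβ
  rw [← ofReal_integral_eq_lintegral_ofReal hint hnonneg]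
  have hb : 0 ≤ ∫ ξ : ℝ, ((ξ - lam) ^ 2)⁻¹ ∂μ := integral_nonneg_of_ae hnonneg
  have hlim := (tendsto_integral_inv_mul_inv μ lam hint).const_add 1
  set b := ∫ ξ : ℝ, ((ξ - lam) ^ 2)⁻¹ ∂μ
  have hb0 : (1 + (b : ℂ)) ≠ 0 := by exact_mod_cast (by positivity : 1 + b ≠ 0)
  have hmass : ν.real {lam} = (1 + b)⁻¹ := by
    have hlim' : Tendsto (fun ε : ℝ => -(ε * I) * ∫ x : ℝ, ((x : ℂ) - (lam + ε * I))⁻¹ ∂ν)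
        (𝓝[>] 0) (𝓝 (1 + (b : ℂ))⁻¹) := by
      refine (hlim.inv₀ hb0).congr' ?_
      filter_upwards [self_mem_nhdsWithin] with ε hε
      have hε' : (ε : ℂ) * I ≠ 0 := mul_ne_zero (by exact_mod_cast ne_of_gt hε) I_ne_zero
      have hs := stieltjes_sub_integral_inv_sub μ lam hα hint hε
      rw [hγ] at hs
      rw [hν _ (by simpa using hε)]
      set J := ∫ x : ℝ, ((x : ℂ) - (lam + ε * I))⁻¹ * ((x - lam : ℝ) : ℂ)⁻¹ ∂μ
      have hden : (lam + ε * I : ℂ) + ∫ x : ℝ, ((x : ℂ) - (lam + ε * I))⁻¹ ∂μ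
          = ε * I * (1 + J) := by
        push_cast at hs
        linear_combination hs
      rw [hden, neg_div, neg_mul_neg, one_div, mul_inv, mul_inv_cancel_left₀ hε']
    exact_mod_cast tendsto_nhds_unique (tendsto_neg_mul_stieltjes ν lam) hlim'
  have hmass' : ν {lam} = (1 + ENNReal.ofReal b)⁻¹ := by
    rw [← ofReal_measureReal, hmass, ENNReal.ofReal_inv_of_pos (by positivity),
      ENNReal.ofReal_add zero_le_one hb, ENNReal.ofReal_one]
  refine ⟨hmass', lintegral_inv_sq_eq_top ν lam ?_⟩
  rw [hmass']
  simp
end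

section
/- Let G be a finite forest with vertex set V and let S ⊆ V. For x ∉ S let deg_S(x) denote the number of neighbors of x in S, and for each connected component C of the subgraph induced by S let ∂C denote the set of vertices outside C having a neighbor in C. Then Σ over the connected components C of the subgraph induced by S of ( 1 − Σ_{x ∈ ∂C} 1/deg_S(x) ) equals (the number of connected components of the subgraph induced by S) minus |∂S|. -/
open Classical

namespace SimpleGraph

variable {V : Type*} {G : SimpleGraph V} {S : Set V}

/-- In a forest, a vertex outside `S` has at most one neighbor in each component of the subgraph
induced by `S`. -/
theorem IsAcyclic.eq_of_adj_of_reachable_induce (hG : G.IsAcyclic) {x : V} (hx : x ∉ S)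
    {y z : S} (hy : G.Adj x y) (hz : G.Adj x z) (h : (G.induce S).Reachable y z) : y = z := by
  obtain ⟨p, hp⟩ := h.exists_isPath
  let f : G.induce S ↪g G := Embedding.induce S
  have hq : (p.map f.toHom).IsPath := hp.map f.injective
  have hxq : x ∉ (p.map f.toHom).support := by
    rw [Walk.support_map]
    intro hmem
    obtain ⟨w, -, hw⟩ := List.mem_map.mp hmem
    exact hx (hw ▸ w.2)
  have hyx : G.Adj x (f.toHom y) := hy
  have hzx : G.Adj x (f.toHom z) := hz
  have hcons : (Walk.cons hyx (p.map f.toHom)).IsPath := hq.cons hxq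
  have hedge : (Walk.cons hzx Walk.nil).IsPath := by simpa using hzx.ne
  have heq := congrArg (fun r : G.Path x (f.toHom z) => r.1.length)
    ((hG.subsingleton_path _ _).elim ⟨_, hcons⟩ ⟨_, hedge⟩)
  simp only [Walk.length_cons, Walk.length_map, Walk.length_nil] at heq
  exact Walk.eq_of_length_eq_zero (p := p) (by omega)

/-- A vertex outside a component of the subgraph induced by `S`, but adjacent to it, lies
outside `S`. -/
theorem ConnectedComponent.notMem_of_adj_induce {c : (G.induce S).ConnectedComponent} {x y : V}
    (hx : x ∉ Subtype.val '' c.supp) (hy : y ∈ Subtype.val '' c.supp) (hxy : G.Adj x y) :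
    x ∉ S := by
  intro hxS
  obtain ⟨y, hyc, rfl⟩ := hy
  have hadj : (G.induce S).Adj ⟨x, hxS⟩ y := hxy
  exact hx ⟨⟨x, hxS⟩, (c.mem_supp_congr_adj hadj).mpr hyc, rfl⟩

/-- In a forest, the number of components of the subgraph induced by `S` adjacent to a vertex
outside `S` is the number of its neighbors in `S`. -/
theorem IsAcyclic.ncard_components_adj (hG : G.IsAcyclic) {x : V} (hx : x ∉ S) :
    {c : (G.induce S).ConnectedComponent | ∃ y ∈ Subtype.val '' c.supp, G.Adj x y}.ncard =
      {y : V | y ∈ S ∧ G.Adj x y}.ncard := by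
  have hcomp : {c : (G.induce S).ConnectedComponent | ∃ y ∈ Subtype.val '' c.supp, G.Adj x y} =
      (G.induce S).connectedComponentMk '' {y : S | G.Adj x y} := by
    ext c
    constructor
    · rintro ⟨_, ⟨y, hyc, rfl⟩, hxy⟩
      exact ⟨y, hxy, hyc⟩
    · rintro ⟨y, hxy, hyc⟩
      exact ⟨y, ⟨y, hyc, rfl⟩, hxy⟩
  have hnbr : {y : V | y ∈ S ∧ G.Adj x y} = Subtype.val '' {y : S | G.Adj x y} := by
    ext y
    simp [and_comm]
  rw [hcomp, hnbr, Set.ncard_image_of_injective _ Subtype.val_injective]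
  exact Set.InjOn.ncard_image fun y hy z hz hyz =>
    hG.eq_of_adj_of_reachable_induce hx hy hz (ConnectedComponent.exact hyz)

end SimpleGraph

/-- Let `G` be a finite forest and `S` a set of vertices. For `x` let
`deg_S(x)` be the number of neighbors of `x` in `S`, and for a connected component `C` of
the subgraph induced by `S` let `∂C` be the set of vertices outside `C` with a neighbor in
`C`. Then `∑_C (1 - ∑_{x ∈ ∂C} 1/deg_S(x))`, the sum ranging over the connected components
of the subgraph induced by `S`, equals the number of these components minus `|∂S|`. -/
theorem stmt_19 {V : Type*} [Fintype V] (G : SimpleGraph V) (hG : G.IsAcyclic)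
    (S : Set V)
    (degS : V → ℕ) (hdegS : ∀ x : V, degS x = {y : V | y ∈ S ∧ G.Adj x y}.ncard)
    (bd : Set V → Set V)
    (hbd : ∀ A : Set V, bd A = {x : V | x ∉ A ∧ ∃ y ∈ A, G.Adj x y}) :
    (∑ c : (G.induce S).ConnectedComponent,
        ((1 : ℝ) - ∑ x ∈ Finset.univ.filter (· ∈ bd (Subtype.val '' c.supp)),
            (1 : ℝ) / degS x))
      = (Nat.card ((G.induce S).ConnectedComponent) : ℝ) - ((bd S).ncard : ℝ) := by
  have mem_bd_component (c : (G.induce S).ConnectedComponent) (x : V) :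
      x ∈ bd (Subtype.val '' c.supp) ↔ x ∉ S ∧ ∃ y ∈ Subtype.val '' c.supp, G.Adj x y := by
    rw [hbd]
    constructor
    · rintro ⟨hx, y, hy, hxy⟩
      exact ⟨c.notMem_of_adj_induce hx hy hxy, y, hy, hxy⟩
    · rintro ⟨hx, h⟩
      refine ⟨?_, h⟩
      rintro ⟨z, -, rfl⟩
      exact hx z.2
  have sum_component (x : V) :
      (∑ c : (G.induce S).ConnectedComponent,
        if x ∈ bd (Subtype.val '' c.supp) then (1 : ℝ) / degS x else 0) =
      if x ∈ bd S then 1 else 0 := by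
    simp only [mem_bd_component]
    by_cases hx : x ∈ S
    · simp [hbd, hx]
    have hcard := hG.ncard_components_adj hx
    rw [← hdegS, Set.ncard_eq_toFinset_card', Set.toFinset_ofPred] at hcard
    simp only [hx, not_false_eq_true, true_and]
    rw [← Finset.sum_filter, Finset.sum_const, hcard, nsmul_eq_mul]
    have hpos : x ∈ bd S ↔ degS x ≠ 0 := by
      rw [hdegS, ← Nat.pos_iff_ne_zero, Set.ncard_pos (Set.toFinite _), hbd]
      exact and_iff_right hx
    by_cases hdeg : degS x = 0
    · simp [hpos, hdeg]
    · rw [if_pos (hpos.mpr hdeg), mul_one_div_cancel (Nat.cast_ne_zero.mpr hdeg)]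
  rw [Finset.sum_sub_distrib]
  congr 1
  · simp
  · simp only [Finset.sum_filter]
    rw [Finset.sum_comm, Finset.sum_congr rfl fun x _ => sum_component x, Finset.sum_boole,
      Set.ncard_eq_toFinset_card']
    congr 2
    ext x
    simp
end
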